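/- arXiv:math/0703340 — 2 statements merged into one kernel-verified Lean document; each statement's English description precedes it below -/
import Mathlib

section
/- At the critical value a* = 4π e^{-γ}, the point s = 1/2 is a double zero of φ₀(a*,·): the holomorphic extension g of s ↦ φ₀(a*, s) to a neighborhood of s = 1/2 satisfies g(1/2) = 0 and g′(1/2) = 0. -/
open Complex

/-- The constant term `φ₀(a,s) = Λ(2s) a^s + Λ(2s-1) a^{1-s}` of the completed
nonholomorphic Eisenstein series for the modular group, where `Λ` is the completed
Riemann zeta function. -/
noncomputable def phi0 (a : ℝ) (s : ℂ) : ℂ :=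
  completedRiemannZeta (2 * s) * (a : ℂ) ^ s +
    completedRiemannZeta (2 * s - 1) * (a : ℂ) ^ (1 - s)

/-- The critical value `a* = 4 π e^{-γ}`, where `γ` is the Euler–Mascheroni constant. -/
noncomputable def aStar : ℝ := 4 * Real.pi * Real.exp (-Real.eulerMascheroniConstant)

lemma phi0_one_sub (a : ℝ) (s : ℂ) : phi0 a (1 - s) = phi0 a s := by
  have h₁ : completedRiemannZeta (2 * (1 - s)) = completedRiemannZeta (2 * s - 1) := by
    rw [← completedRiemannZeta_one_sub]; ring_nf
  have h₂ : completedRiemannZeta (2 * (1 - s) - 1) = completedRiemannZeta (2 * s) := by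
    rw [← completedRiemannZeta_one_sub]; ring_nf
  rw [phi0, phi0, h₁, h₂, sub_sub_cancel, add_comm]

lemma aStar_pos : 0 < aStar := by
  unfold aStar; positivity

lemma log_aStar : log (aStar : ℂ) = log (4 * Real.pi) - Real.eulerMascheroniConstant := by
  have h4π : (0 : ℝ) < 4 * Real.pi := by positivity
  have h : Real.log aStar = Real.log (4 * Real.pi) - Real.eulerMascheroniConstant := by
    rw [aStar, Real.log_mul h4π.ne' (Real.exp_pos _).ne', Real.log_exp, sub_eq_add_neg]
  rw [← ofReal_log aStar_pos.le, h, ofReal_sub, ofReal_log h4π.le, ofReal_mul, ofReal_ofNat]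

/-- The function `s ↦ φ₀(a,s)` with its singularity at `s = 1/2` removed: the polar parts of the
two terms are combined into the difference quotient of `a^s - a^{1-s}` at `1/2`. -/
noncomputable def phi0Ext (a : ℝ) (s : ℂ) : ℂ :=
  (completedRiemannZeta₀ (2 * s) - 1 / (2 * s)) * (a : ℂ) ^ s +
    (completedRiemannZeta₀ (2 * s - 1) - 1 / (2 - 2 * s)) * (a : ℂ) ^ (1 - s) +
    dslope (fun z : ℂ ↦ (a : ℂ) ^ z - (a : ℂ) ^ (1 - z)) (1 / 2) s / 2

lemma phi0Ext_eq_phi0 (a : ℝ) {s : ℂ} (hs : s ≠ 1 / 2) : phi0Ext a s = phi0 a s := by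
  have h : 2 * s - 1 ≠ 0 := fun h ↦ hs (by linear_combination h / 2)
  have hinv : (s - 1 / 2)⁻¹ = 2 / (2 * s - 1) := by
    rw [eq_div_iff h, inv_mul_eq_iff_eq_mul₀ (sub_ne_zero.mpr hs)]; ring
  have hneg : 1 / (1 - 2 * s) = -(1 / (2 * s - 1)) := by
    rw [← neg_sub (2 * s) 1, div_neg]
  have hhalf : (1 : ℂ) - 1 / 2 = 1 / 2 := by norm_num
  have htwo : (1 : ℂ) - (2 * s - 1) = 2 - 2 * s := by ring
  rw [phi0Ext, phi0, dslope_of_ne _ hs, slope_def_field, completedRiemannZeta_eq,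
    completedRiemannZeta_eq, hneg, htwo, hhalf, div_eq_mul_inv _ (s - 1 / 2), hinv]
  ring

lemma phi0Ext_one_sub (a : ℝ) (s : ℂ) : phi0Ext a (1 - s) = phi0Ext a s := by
  rcases eq_or_ne s (1 / 2) with rfl | hs
  · norm_num
  · have hs' : 1 - s ≠ 1 / 2 := fun h ↦ hs (by linear_combination -h)
    rw [phi0Ext_eq_phi0 a hs, phi0Ext_eq_phi0 a hs', phi0_one_sub]

lemma deriv_phi0Ext_half (a : ℝ) : deriv (phi0Ext a) (1 / 2) = 0 := by
  have h := deriv_comp_const_sub (f := phi0Ext a) (a := 1) (x := 1 / 2)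
  simp only [phi0Ext_one_sub] at h
  rw [show (1 : ℂ) - 1 / 2 = 1 / 2 by norm_num] at h
  exact self_eq_neg.mp h

lemma hasDerivAt_cpow_sub_cpow_one_sub {a : ℝ} (ha : 0 < a) (s : ℂ) :
    HasDerivAt (fun z : ℂ ↦ (a : ℂ) ^ z - (a : ℂ) ^ (1 - z))
      (((a : ℂ) ^ s + (a : ℂ) ^ (1 - s)) * log a) s := by
  have ha' : (a : ℂ) ≠ 0 := ofReal_ne_zero.mpr ha.ne'
  convert! ((hasDerivAt_id s).const_cpow (Or.inl ha')).sub
    (((hasDerivAt_id s).const_sub 1).const_cpow (Or.inl ha')) using 1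
  simp only [id]
  ring

lemma differentiableOn_phi0Ext {a : ℝ} (ha : 0 < a) :
    DifferentiableOn ℂ (phi0Ext a) {0, 1}ᶜ := by
  have ha' : (a : ℂ) ≠ 0 := ofReal_ne_zero.mpr ha.ne'
  have hd : Differentiable ℂ (dslope (fun z : ℂ ↦ (a : ℂ) ^ z - (a : ℂ) ^ (1 - z)) (1 / 2)) := by
    rw [← differentiableOn_univ, differentiableOn_dslope Filter.univ_mem]
    exact fun s _ ↦ (hasDerivAt_cpow_sub_cpow_one_sub ha s).differentiableAt.differentiableWithinAt
  have hp : Differentiable ℂ fun z : ℂ ↦ (a : ℂ) ^ z := fun s ↦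
    differentiableAt_id.const_cpow (Or.inl ha')
  have hp' : Differentiable ℂ fun z : ℂ ↦ (a : ℂ) ^ (1 - z) := hp.comp (by fun_prop)
  have hz : Differentiable ℂ fun z : ℂ ↦ completedRiemannZeta₀ (2 * z) :=
    differentiable_completedZeta₀.comp (by fun_prop)
  have hz' : Differentiable ℂ fun z : ℂ ↦ completedRiemannZeta₀ (2 * z - 1) :=
    differentiable_completedZeta₀.comp (by fun_prop)
  intro s hs
  simp only [Set.mem_compl_iff, Set.mem_insert_iff, Set.mem_singleton_iff, not_or] at hs
  have h₀ : 2 * s ≠ 0 := mul_ne_zero two_ne_zero hs.1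
  have h₁ : 2 - 2 * s ≠ 0 := fun h ↦ hs.2 (by linear_combination -h / 2)
  have hr : DifferentiableAt ℂ (fun z : ℂ ↦ 1 / (2 * z)) s := by fun_prop (disch := assumption)
  have hr' : DifferentiableAt ℂ (fun z : ℂ ↦ 1 / (2 - 2 * z)) s := by
    fun_prop (disch := assumption)
  exact ((((hz s).sub hr).mul (hp s)).add (((hz' s).sub hr').mul (hp' s))
    |>.add ((hd s).div_const 2)).differentiableWithinAt

lemma phi0Ext_aStar_half : phi0Ext aStar (1 / 2) = 0 := by
  have hhalf : (1 : ℂ) - 1 / 2 = 1 / 2 := by norm_num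
  have h₁ : (2 : ℂ) * (1 / 2) = 1 := by norm_num
  rw [phi0Ext, dslope_same, (hasDerivAt_cpow_sub_cpow_one_sub aStar_pos _).deriv, hhalf, h₁,
    sub_self, completedRiemannZeta₀_zero, completedRiemannZeta₀_one, log_aStar]
  ring

/-- At the critical value `a* = 4πe^{-γ}`, the point `s = 1/2` is a double zero of
`φ₀(a*,·)`: the holomorphic extension `g` of `s ↦ φ₀(a*, s)` to a neighborhood of
`s = 1/2` satisfies `g(1/2) = 0` and `g′(1/2) = 0`. -/
theorem phi0_double_zero_at_half_at_aStar :
    ∃ (g : ℂ → ℂ) (U : Set ℂ), IsOpen U ∧ (1 / 2 : ℂ) ∈ U ∧ DifferentiableOn ℂ g U ∧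
      (∀ s ∈ U, s ≠ 1 / 2 → g s = phi0 aStar s) ∧
      g (1 / 2) = 0 ∧ deriv g (1 / 2) = 0 := by
  exact ⟨phi0Ext aStar, {0, 1}ᶜ, (Set.toFinite _).isClosed.isOpen_compl, by norm_num,
    differentiableOn_phi0Ext aStar_pos, fun _ _ hs ↦ phi0Ext_eq_phi0 aStar hs,
    phi0Ext_aStar_half, deriv_phi0Ext_half aStar⟩
end

section
/- For every real number a ≥ 1, every non-real zero of φ_K(a,·) lies on the line Re(s) = 1: if s ∈ ℂ satisfies Im(s) ≠ 0 and φ_K(a,s) = 0, then Re(s) = 1. -/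
open Complex Filter NumberField

/-- The Dedekind zeta function of a number field `K`, given (for `Re(s) > 1`) as the
sum of `N(I)^{-s}` over the nonzero ideals `I` of the ring of integers of `K`. -/
noncomputable def dedekindZetaSum (K : Type*) [Field K] [NumberField K] (s : ℂ) : ℂ :=
  ∑' I : {I : Ideal (𝓞 K) // I ≠ ⊥}, (Ideal.absNorm I.1 : ℂ) ^ (-s)

/-- `ΛK` is the completed Dedekind zeta function of `K`:
`Λ_K(s) = (√|d_K|/(2π))^s Γ(s) ζ_K(s)` for `Re(s) > 1`, holomorphic away from
(simple) poles at `s = 0` and `s = 1`, and satisfying `Λ_K(s) = Λ_K(1-s)`. -/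
structure IsCompletedDedekindZeta (K : Type*) [Field K] [NumberField K]
    (ΛK : ℂ → ℂ) : Prop where
  eq_on_gt_one : ∀ s : ℂ, 1 < s.re → ΛK s =
    ((Real.sqrt |(NumberField.discr K : ℝ)| / (2 * Real.pi) : ℝ) : ℂ) ^ s *
      Complex.Gamma s * dedekindZetaSum K s
  differentiableOn : DifferentiableOn ℂ ΛK {(0 : ℂ), 1}ᶜ
  functional_equation : ∀ s : ℂ, ΛK s = ΛK (1 - s)
  simple_pole_at_one : ∃ r : ℂ, r ≠ 0 ∧
    Tendsto (fun s : ℂ => (s - 1) * ΛK s) (nhdsWithin 1 {(1 : ℂ)}ᶜ) (nhds r)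

/-- The constant term `φ_K(a,s) = a^s Λ_K(s) + a^{2-s} Λ_K(s-1)` of the Eisenstein
series attached to `PSL(2, 𝓞_K)`. -/
noncomputable def phiK (ΛK : ℂ → ℂ) (a : ℝ) (s : ℂ) : ℂ :=
  (a : ℂ) ^ s * ΛK s + (a : ℂ) ^ (2 - s) * ΛK (s - 1)

open HurwitzZeta Set Asymptotics Topology in
lemma abs_cosKernel_sub_one_le (a : ℝ) {t : ℝ} (ht : 0 < t) :
    |cosKernel a t - 1| ≤ evenKernel 0 t - 1 := by
  have h1 := hasSum_int_cosKernel₀ a ht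
  have h2 := hasSum_int_evenKernel₀ 0 ht
  simp only [add_zero, Int.cast_eq_zero, QuotientAddGroup.mk_zero, if_true] at h2
  have h3 := h1.norm_le_of_bounded h2 (fun n => ?_)
  · rw [← Complex.ofReal_one, ← Complex.ofReal_sub, Complex.norm_real] at h3
    exact h3
  · split_ifs with h
    · simp
    · rw [norm_mul, Complex.norm_real, Real.norm_eq_abs, abs_of_pos (Real.exp_pos _)]
      have : 2 * (Real.pi : ℂ) * I * a * n = ((2 * Real.pi * a * n : ℝ) : ℂ) * I := by
        push_cast; ring
      rw [this, Complex.norm_exp_ofReal_mul_I, one_mul]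

/-- The value of the positive definite form `A (m + β n)² + D n²`. -/
noncomputable def quadForm (A β D : ℝ) (p : ℤ × ℤ) : ℝ :=
  A * (p.1 + β * p.2) ^ 2 + D * p.2 ^ 2

open HurwitzZeta in
lemma hasSum_quadForm_fiber (A β D : ℝ) (hA : 0 < A) {t : ℝ} (ht : 0 < t) (n : ℤ) :
    HasSum (fun m : ℤ => Real.exp (-t * quadForm A β D (m, n)))
      (Real.exp (-t * (D * n ^ 2)) * evenKernel ((β * n : ℝ) : UnitAddCircle) (t * A / Real.pi)) := by
  have h := (hasSum_int_evenKernel (β * n) (t := t * A / Real.pi) (by positivity)).mul_left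
    (Real.exp (-t * (D * n ^ 2)))
  refine h.congr_fun (fun m => ?_)
  rw [← Real.exp_add, quadForm]
  congr 1
  field_simp
  ring

open HurwitzZeta in
lemma hasSum_exp_neg_mul_sq {D t : ℝ} (hD : 0 < D) (ht : 0 < t) :
    HasSum (fun n : ℤ => Real.exp (-t * (D * n ^ 2))) (evenKernel 0 (t * D / Real.pi)) := by
  have h := hasSum_int_evenKernel 0 (t := t * D / Real.pi) (by positivity)
  simp only [add_zero, QuotientAddGroup.mk_zero] at h
  convert h using 3 with n
  field_simp

open HurwitzZeta in
lemma one_le_evenKernel_zero {t : ℝ} (ht : 0 < t) : 1 ≤ evenKernel 0 t := by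
  have := (abs_nonneg _).trans (abs_cosKernel_sub_one_le 0 ht)
  linarith

open HurwitzZeta in
lemma abs_evenKernel_sub_le (a : ℝ) {x : ℝ} (hx : 0 < x) :
    |evenKernel a x - 1 / x ^ (1 / 2 : ℝ)| ≤
      1 / x ^ (1 / 2 : ℝ) * (evenKernel 0 (1 / x) - 1) := by
  have hp : 0 < 1 / x ^ (1 / 2 : ℝ) := by positivity
  rw [evenKernel_functional_equation,
    show 1 / x ^ (1 / 2 : ℝ) * cosKernel a (1 / x) - 1 / x ^ (1 / 2 : ℝ) =
      1 / x ^ (1 / 2 : ℝ) * (cosKernel a (1 / x) - 1) by ring, abs_mul, abs_of_pos hp]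
  exact mul_le_mul_of_nonneg_left (abs_cosKernel_sub_one_le a (by positivity)) hp.le

open HurwitzZeta in
lemma summable_exp_neg_quadForm {A D : ℝ} (β : ℝ) (hA : 0 < A) (hD : 0 < D) {t : ℝ} (ht : 0 < t) :
    Summable (fun p : ℤ × ℤ => Real.exp (-t * quadForm A β D p)) := by
  rw [← (Equiv.prodComm ℤ ℤ).summable_iff]
  refine (summable_prod_of_nonneg (fun _ => (Real.exp_pos _).le)).2
    ⟨fun n => (hasSum_quadForm_fiber A β D hA ht n).summable, ?_⟩
  have h1 : ∀ n : ℤ, (∑' m : ℤ, Real.exp (-t * quadForm A β D (m, n))) = _ :=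
    fun n => (hasSum_quadForm_fiber A β D hA ht n).tsum_eq
  simp only [Equiv.prodComm_apply, Prod.swap_prod_mk, h1]
  set x := t * A / Real.pi with hx
  have hx0 : 0 < x := by positivity
  refine Summable.of_nonneg_of_le (fun n => ?_) (fun n => ?_)
    ((hasSum_exp_neg_mul_sq hD ht).summable.mul_right
      (1 / x ^ (1 / 2 : ℝ) + 1 / x ^ (1 / 2 : ℝ) * (evenKernel 0 (1 / x) - 1)))
  · rw [← h1]
    exact tsum_nonneg fun _ => (Real.exp_pos _).le
  · refine mul_le_mul_of_nonneg_left ?_ (Real.exp_pos _).le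
    have := (abs_le.1 (abs_evenKernel_sub_le (β * n) hx0)).2
    linarith

open HurwitzZeta in
lemma abs_theta_sub_le {A D : ℝ} (β : ℝ) (hA : 0 < A) (hD : 0 < D) {t x y : ℝ} (ht : 0 < t)
    (hx : x = t * A / Real.pi) (hy : y = t * D / Real.pi) :
    |(∑' p : ℤ × ℤ, Real.exp (-t * quadForm A β D p)) - 1 / x ^ (1 / 2 : ℝ) * (1 / y ^ (1 / 2 : ℝ))|
      ≤ 1 / x ^ (1 / 2 : ℝ) * (1 / y ^ (1 / 2 : ℝ)) * ((evenKernel 0 (1 / y) - 1) +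
        (evenKernel 0 (1 / x) - 1) * evenKernel 0 (1 / y)) := by
  have hx0 : 0 < x := by rw [hx]; positivity
  have hy0 : 0 < y := by rw [hy]; positivity
  have hs := (Equiv.prodComm ℤ ℤ).summable_iff.2 (summable_exp_neg_quadForm β hA hD ht)
  simp only [Function.comp_def] at hs
  rw [← (Equiv.prodComm ℤ ℤ).tsum_eq, Summable.tsum_prod hs]
  have h1 : ∀ n : ℤ, (∑' m : ℤ, Real.exp (-t * quadForm A β D (m, n))) = _ :=
    fun n => (hasSum_quadForm_fiber A β D hA ht n).tsum_eq
  simp only [Equiv.prodComm_apply, Prod.swap_prod_mk, h1]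
  have hsum := hs.prod
  simp only [Equiv.prodComm_apply, Prod.swap_prod_mk, h1] at hsum
  rw [← hx] at hsum ⊢
  have h2 := hasSum_exp_neg_mul_sq hD ht
  rw [← hy] at h2
  have h3 := hsum.hasSum.sub (h2.mul_right (1 / x ^ (1 / 2 : ℝ)))
  have h4 := h3.norm_le_of_bounded (h2.mul_right (1 / x ^ (1 / 2 : ℝ) * (evenKernel 0 (1 / x) - 1)))
    (fun n => by
      rw [← mul_sub, norm_mul, Real.norm_eq_abs, abs_of_pos (Real.exp_pos _)]
      exact mul_le_mul_of_nonneg_left (abs_evenKernel_sub_le _ hx0) (Real.exp_pos _).le)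
  rw [Real.norm_eq_abs] at h4
  have h5 : evenKernel 0 y = 1 / y ^ (1 / 2 : ℝ) * evenKernel 0 (1 / y) := by
    rw [evenKernel_functional_equation, ← evenKernel_eq_cosKernel_of_zero]
  rw [h5] at h4
  have h6 := one_le_evenKernel_zero (t := 1 / y) (by positivity)
  have hX : 0 < 1 / x ^ (1 / 2 : ℝ) := by positivity
  have hY : 0 < 1 / y ^ (1 / 2 : ℝ) := by positivity
  generalize 1 / x ^ (1 / 2 : ℝ) = X at *
  generalize 1 / y ^ (1 / 2 : ℝ) = Y at *
  have h7 : 0 ≤ X * Y * (evenKernel 0 (1 / y) - 1) := by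
    have : 0 ≤ evenKernel 0 (1 / y) - 1 := by linarith
    positivity
  rw [abs_le] at h4 ⊢
  constructor <;> nlinarith [h4.1, h4.2, h7]

open HurwitzZeta Asymptotics Topology in
lemma isBigO_evenKernel_zero_sub_one {c : ℝ} (hc : 0 < c) :
    (fun t : ℝ => evenKernel 0 (1 / (t * c)) - 1) =O[𝓝[>] 0] (fun t => t) := by
  obtain ⟨p, hp, h⟩ := isBigO_atTop_evenKernel_sub 0
  simp only [if_true] at h
  have h1 : (fun x => evenKernel 0 x - 1) =O[atTop] (fun x : ℝ => x⁻¹) := by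
    have := (isLittleO_exp_neg_mul_rpow_atTop hp (-1)).isBigO
    refine (h.trans this).congr_right (fun x => ?_)
    rw [Real.rpow_neg_one]
  have h2 : Tendsto (fun t : ℝ => 1 / (t * c)) (𝓝[>] 0) atTop := by
    have : (fun t : ℝ => 1 / (t * c)) = fun t => t⁻¹ * c⁻¹ := by
      ext t; rw [one_div, mul_inv]
    rw [this]
    exact tendsto_inv_nhdsGT_zero.atTop_mul_const (by positivity)
  refine (h1.comp_tendsto h2).trans ?_
  refine IsBigO.of_bound c (Eventually.of_forall fun t => ?_)
  simp [abs_of_pos hc, mul_comm]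

open HurwitzZeta Asymptotics Topology in
lemma exists_theta_sub_isBigO {A D : ℝ} (β : ℝ) (hA : 0 < A) (hD : 0 < D) :
    ∃ c : ℝ, (fun t : ℝ => (∑' p : ℤ × ℤ, Real.exp (-t * quadForm A β D p)) - c / t)
      =O[𝓝[>] 0] (fun _ => (1 : ℝ)) := by
  refine ⟨1 / (A / Real.pi) ^ (1 / 2 : ℝ) * (1 / (D / Real.pi) ^ (1 / 2 : ℝ)), ?_⟩
  set c := 1 / (A / Real.pi) ^ (1 / 2 : ℝ) * (1 / (D / Real.pi) ^ (1 / 2 : ℝ)) with hc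
  have hX := isBigO_evenKernel_zero_sub_one (c := A / Real.pi) (by positivity)
  have hY := isBigO_evenKernel_zero_sub_one (c := D / Real.pi) (by positivity)
  have hid : (fun t : ℝ => t) =O[𝓝[>] 0] (fun _ => (1 : ℝ)) :=
    ((continuous_id.tendsto (0 : ℝ)).mono_left nhdsWithin_le_nhds).isBigO_one ℝ
  have hY1 : (fun t : ℝ => evenKernel 0 (1 / (t * (D / Real.pi)))) =O[𝓝[>] 0]
      (fun _ => (1 : ℝ)) := by
    have := (hY.trans hid).add (isBigO_refl (fun _ : ℝ => (1 : ℝ)) (𝓝[>] (0 : ℝ)))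
    simpa using this
  have hsum := hY.add ((hX.mul hY1).congr_right (g₂ := fun t => t) (fun t => by simp))
  have hct : (fun t : ℝ => c / t) =O[𝓝[>] 0] (fun t => t⁻¹) :=
    (isBigO_refl _ _).const_mul_left c
  have hfin := (hct.mul hsum)
  have hev : (fun t : ℝ => t⁻¹ * t) =ᶠ[𝓝[>] 0] fun _ => (1 : ℝ) := by
    filter_upwards [self_mem_nhdsWithin] with t ht
    exact inv_mul_cancel₀ (ne_of_gt ht)
  refine IsBigO.trans (IsBigO.of_bound 1 ?_) (hfin.trans hev.isBigO)
  filter_upwards [self_mem_nhdsWithin] with t ht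
  have ht : 0 < t := ht
  have hxy : 1 / (t * (A / Real.pi)) ^ (1 / 2 : ℝ) * (1 / (t * (D / Real.pi)) ^ (1 / 2 : ℝ)) =
      c / t := by
    rw [Real.mul_rpow ht.le (by positivity), Real.mul_rpow ht.le (by positivity), hc]
    have : t ^ (1 / 2 : ℝ) * t ^ (1 / 2 : ℝ) = t := by
      rw [← Real.rpow_add ht]; norm_num
    field_simp
    rw [sq, this]
  have h := abs_theta_sub_le β hA hD ht (x := t * (A / Real.pi)) (y := t * (D / Real.pi))
    (by ring) (by ring)
  rw [hxy] at h
  rw [one_mul]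
  exact h.trans (le_abs_self _)

lemma quadForm_nonneg {A β D : ℝ} (hA : 0 < A) (hD : 0 < D) (p : ℤ × ℤ) :
    0 ≤ quadForm A β D p := by
  unfold quadForm; positivity

lemma exists_sq_norm_le_quadForm {A D : ℝ} (β : ℝ) (hA : 0 < A) (hD : 0 < D) :
    ∃ C : ℝ, 0 < C ∧ ∀ p : ℤ × ℤ, ‖(![p.1, p.2] : Fin 2 → ℤ)‖ ^ 2 ≤ C * quadForm A β D p := by
  refine ⟨2 / A + (2 * β ^ 2 + 1) / D, by positivity, fun p => ?_⟩
  have hm : (p.1 : ℝ) ^ 2 ≤ (2 / A + (2 * β ^ 2 + 1) / D) * quadForm A β D p := by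
    have h1 : (p.1 : ℝ) ^ 2 ≤ 2 * (p.1 + β * p.2) ^ 2 + 2 * β ^ 2 * p.2 ^ 2 := by
      nlinarith [sq_nonneg ((p.1 : ℝ) + 2 * β * p.2)]
    refine h1.trans ?_
    unfold quadForm
    have e : (2 / A + (2 * β ^ 2 + 1) / D) * (A * (p.1 + β * p.2) ^ 2 + D * p.2 ^ 2) =
      2 * (p.1 + β * p.2) ^ 2 + 2 * β ^ 2 * p.2 ^ 2 + (2 / A * (D * p.2 ^ 2) + p.2 ^ 2 +
        (2 * β ^ 2 + 1) / D * (A * (p.1 + β * p.2) ^ 2)) := by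
      field_simp
      ring
    rw [e]
    have : 0 ≤ 2 / A * (D * (p.2 : ℝ) ^ 2) + p.2 ^ 2 +
        (2 * β ^ 2 + 1) / D * (A * (p.1 + β * p.2) ^ 2) := by positivity
    linarith
  have hn : (p.2 : ℝ) ^ 2 ≤ (2 / A + (2 * β ^ 2 + 1) / D) * quadForm A β D p := by
    unfold quadForm
    have e : (2 / A + (2 * β ^ 2 + 1) / D) * (A * (p.1 + β * p.2) ^ 2 + D * p.2 ^ 2) =
      p.2 ^ 2 + (2 / A * (D * p.2 ^ 2) + 2 * β ^ 2 * p.2 ^ 2 + 2 * (p.1 + β * p.2) ^ 2 +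
        (2 * β ^ 2 + 1) / D * (A * (p.1 + β * p.2) ^ 2)) := by
      field_simp
      ring
    rw [e]
    have : 0 ≤ 2 / A * (D * (p.2 : ℝ) ^ 2) + 2 * β ^ 2 * p.2 ^ 2 + 2 * (p.1 + β * p.2) ^ 2 +
        (2 * β ^ 2 + 1) / D * (A * (p.1 + β * p.2) ^ 2) := by positivity
    linarith
  have : ‖(![p.1, p.2] : Fin 2 → ℤ)‖ ≤ √((2 / A + (2 * β ^ 2 + 1) / D) * quadForm A β D p) := by
    refine (pi_norm_le_iff_of_nonneg (Real.sqrt_nonneg _)).2 (fun i => ?_)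
    apply Real.le_sqrt_of_sq_le
    fin_cases i
    · simpa [Int.norm_eq_abs] using hm
    · simpa [Int.norm_eq_abs] using hn
  calc _ ≤ _ := pow_le_pow_left₀ (norm_nonneg _) this 2
    _ = _ := Real.sq_sqrt (by have := quadForm_nonneg (β := β) hA hD p; positivity)

lemma summable_quadForm_rpow {A D : ℝ} (β : ℝ) (hA : 0 < A) (hD : 0 < D) {σ : ℝ} (hσ : 1 < σ) :
    Summable (fun p : ℤ × ℤ => quadForm A β D p ^ (-σ)) := by
  obtain ⟨C, hC, h⟩ := exists_sq_norm_le_quadForm β hA hD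
  have h1 := EisensteinSeries.summable_one_div_norm_rpow (k := 2 * σ) (by linarith)
  rw [← (finTwoArrowEquiv ℤ).symm.summable_iff] at h1
  refine Summable.of_nonneg_of_le (fun p => Real.rpow_nonneg (quadForm_nonneg hA hD p) _)
    (fun p => ?_) (h1.mul_left (C ^ σ))
  have hq := quadForm_nonneg (β := β) hA hD p
  simp only [Function.comp_apply, finTwoArrowEquiv_symm_apply]
  set N := ‖(![p.1, p.2] : Fin 2 → ℤ)‖ with hN
  have hN0 : 0 ≤ N := norm_nonneg _
  have hp := h p
  rw [← hN] at hp
  rcases hN0.eq_or_lt with h0 | h0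
  · have hv : (![p.1, p.2] : Fin 2 → ℤ) = 0 := norm_eq_zero.1 (hN ▸ h0.symm)
    have e1 : p.1 = 0 := by simpa using congrFun hv 0
    have e2 : p.2 = 0 := by simpa using congrFun hv 1
    have : quadForm A β D p = 0 := by simp [quadForm, e1, e2]
    rw [this, ← h0, Real.zero_rpow (by linarith), Real.zero_rpow (by linarith), mul_zero]
  · have hq0 : 0 < quadForm A β D p := by
      by_contra hcon
      have : quadForm A β D p = 0 := le_antisymm (not_lt.1 hcon) hq
      rw [this] at hp
      nlinarith
    rw [show -(2 * σ) = 2 * (-σ) by ring, Real.rpow_mul hN0, Real.rpow_two,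
      Real.rpow_neg (by positivity), Real.rpow_neg (by positivity), ← div_eq_mul_inv,
      inv_le_comm₀ (by positivity) (by positivity), inv_div, div_le_iff₀ (by positivity),
      mul_comm, ← Real.mul_rpow hC.le hq]
    exact Real.rpow_le_rpow (by positivity) hp (by linarith)

lemma exists_embedding_absNorm_eq (K : Type*) [Field K] [NumberField K]
    (hdeg : Module.finrank ℚ K = 2) (himag : ∀ v : InfinitePlace K, v.IsComplex) :
    ∃ σ : K →+* ℂ, ∀ x : 𝓞 K, (Ideal.absNorm (Ideal.span {x}) : ℝ) = ‖σ x‖ ^ 2 := by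
  classical
  have hsum := InfinitePlace.sum_mult_eq (K := K)
  simp only [fun w => InfinitePlace.IsComplex.mult_eq_two (himag w), hdeg,
    Finset.sum_const, Finset.card_univ, smul_eq_mul] at hsum
  have hcard : Fintype.card (InfinitePlace K) = 1 := by omega
  obtain ⟨v, hv⟩ := Fintype.card_eq_one_iff.1 hcard
  refine ⟨v.embedding, fun x => ?_⟩
  have : Subsingleton (InfinitePlace K) := ⟨fun a b => (hv a).trans (hv b).symm⟩
  have h := InfinitePlace.prod_eq_abs_norm (x : K)
  rw [Fintype.prod_subsingleton _ v, InfinitePlace.IsComplex.mult_eq_two (himag v)] at h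
  rw [InfinitePlace.norm_embedding_eq, h, Ideal.absNorm_span_singleton, ← Algebra.coe_norm_int]
  simp only [Nat.cast_natAbs]
  push_cast
  rfl

lemma exists_quadForm_equiv (K : Type*) [Field K] [NumberField K]
    (hdeg : Module.finrank ℚ K = 2) (himag : ∀ v : InfinitePlace K, v.IsComplex) :
    ∃ (e : ℤ × ℤ ≃ 𝓞 K) (A β D : ℝ), 0 < A ∧ 0 < D ∧ e 0 = 0 ∧
      ∀ p, (Ideal.absNorm (Ideal.span {e p}) : ℝ) = quadForm A β D p := by
  obtain ⟨σ, hσ⟩ := exists_embedding_absNorm_eq K hdeg himag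
  let b : Module.Basis (Fin 2) ℤ (𝓞 K) := Module.finBasisOfFinrankEq ℤ (𝓞 K)
    ((RingOfIntegers.rank K).trans hdeg)
  let e : ℤ × ℤ ≃ 𝓞 K := (finTwoArrowEquiv ℤ).symm.trans b.equivFun.symm.toEquiv
  have he : ∀ p : ℤ × ℤ, e p = p.1 • b 0 + p.2 • b 1 := fun p => by
    simp [e, Module.Basis.equivFun_symm_apply]
  set u : ℂ := σ (b 0) with hu
  set v : ℂ := σ (b 1) with hv
  set A : ℝ := ‖u‖ ^ 2 with hA
  set B : ℝ := (u * (starRingEnd ℂ) v).re with hB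
  set C : ℝ := ‖v‖ ^ 2 with hC
  have hN : ∀ p : ℤ × ℤ, (Ideal.absNorm (Ideal.span {e p}) : ℝ) =
      A * p.1 ^ 2 + 2 * B * p.1 * p.2 + C * p.2 ^ 2 := fun p => by
    rw [hσ, he]
    have : σ ((p.1 • b 0 + p.2 • b 1 : 𝓞 K) : K) = p.1 * u + p.2 * v := by
      simp [hu, hv]
    rw [this, hA, hB, hC, ← Complex.normSq_eq_norm_sq, ← Complex.normSq_eq_norm_sq,
      ← Complex.normSq_eq_norm_sq]
    simp [Complex.normSq_apply]
    ring
  have hpos : ∀ p : ℤ × ℤ, p ≠ 0 → 0 < A * p.1 ^ 2 + 2 * B * p.1 * p.2 + C * p.2 ^ 2 := by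
    intro p hp
    rw [← hN, Nat.cast_pos, Nat.pos_iff_ne_zero, Ne, Ideal.absNorm_eq_zero_iff,
      Ideal.span_singleton_eq_bot]
    intro h0
    exact hp (e.injective (h0.trans (by simp [he])))
  have hA0 : 0 < A := by simpa using hpos (1, 0) (by simp)
  obtain ⟨a, ha⟩ : ∃ a : ℤ, (a : ℝ) = A := ⟨Ideal.absNorm (Ideal.span {e (1, 0)}), by
    have := hN (1, 0)
    push_cast; simpa using this⟩
  obtain ⟨k, hk⟩ : ∃ k : ℤ, (k : ℝ) = 2 * B :=
    ⟨Ideal.absNorm (Ideal.span {e (1, 1)}) - Ideal.absNorm (Ideal.span {e (1, 0)}) -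
      Ideal.absNorm (Ideal.span {e (0, 1)}), by
    have h1 := hN (1, 1)
    have h2 := hN (1, 0)
    have h3 := hN (0, 1)
    push_cast at h1 h2 h3 ⊢
    rw [h1, h2, h3]; ring⟩
  have hdisc : 0 < A * C - B ^ 2 := by
    have ha0 : a ≠ 0 := by rintro rfl; simp at ha; linarith
    have h := hpos (-k, 2 * a) (by simp [ha0])
    push_cast at h
    rw [ha, hk] at h
    have : 0 < 4 * A * (A * C - B ^ 2) := by nlinarith
    exact pos_of_mul_pos_right this (by positivity)
  refine ⟨e, A, B / A, (A * C - B ^ 2) / A, hA0, by positivity, by simp [he], fun p => ?_⟩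
  rw [hN, quadForm]
  field_simp
  ring

lemma exists_ideal_unit_equiv (K : Type*) [Field K] [NumberField K]
    (hdeg : Module.finrank ℚ K = 2) (himag : ∀ v : InfinitePlace K, v.IsComplex)
    (hclass : classNumber K = 1) :
    ∃ (A β D : ℝ) (E : {I : Ideal (𝓞 K) // I ≠ ⊥} × (𝓞 K)ˣ ≃ {p : ℤ × ℤ // p ≠ 0}),
      0 < A ∧ 0 < D ∧ ∀ q, quadForm A β D (E q).1 = Ideal.absNorm q.1.1 := by
  obtain ⟨e, A, β, D, hA, hD, he0, he⟩ := exists_quadForm_equiv K hdeg himag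
  have := (NumberField.classNumber_eq_one_iff).1 hclass
  let g : Ideal (𝓞 K) → 𝓞 K := fun I => Submodule.IsPrincipal.generator I
  have hg : ∀ I, Ideal.span {g I} = I := fun I => Ideal.span_singleton_generator I
  have hg0 : ∀ I : {I : Ideal (𝓞 K) // I ≠ ⊥}, g I.1 ≠ 0 := fun I h => I.2 (by
    rw [← hg I.1, h]; simp)
  let F : {I : Ideal (𝓞 K) // I ≠ ⊥} × (𝓞 K)ˣ → {p : ℤ × ℤ // p ≠ 0} := fun q =>
    ⟨e.symm (g q.1.1 * q.2), fun h => by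
      rw [Equiv.symm_apply_eq, he0] at h
      exact mul_ne_zero (hg0 q.1) q.2.ne_zero h⟩
  have hF : ∀ q, Ideal.span {e (F q).1} = q.1.1 := fun q => by
    simp only [F, Equiv.apply_symm_apply]
    rw [Ideal.span_singleton_mul_right_unit q.2.isUnit, hg]
  have hbij : Function.Bijective F := by
    constructor
    · rintro ⟨I, u⟩ ⟨J, v⟩ h
      have hIJ : I = J := Subtype.ext (by rw [← hF (I, u), ← hF (J, v), h])
      subst hIJ
      have h2 := e.symm.injective (congrArg Subtype.val h)
      have h3 := Units.ext (mul_left_cancel₀ (hg0 I) h2)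
      exact congrArg (Prod.mk I) h3
    · rintro ⟨p, hp⟩
      have hep : e p ≠ 0 := fun h => hp (e.injective (h.trans he0.symm))
      let I : {I : Ideal (𝓞 K) // I ≠ ⊥} := ⟨Ideal.span {e p}, by
        rwa [Ne, Ideal.span_singleton_eq_bot]⟩
      obtain ⟨u, hu⟩ := Ideal.span_singleton_eq_span_singleton.1 (hg I.1)
      refine ⟨(I, u), Subtype.ext ?_⟩
      simp only [F]
      rw [hu, Equiv.symm_apply_apply]
  refine ⟨A, β, D, Equiv.ofBijective F hbij, hA, hD, fun q => ?_⟩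
  rw [Equiv.ofBijective_apply, ← he, hF]

lemma summable_absNorm_rpow_prod_units {K : Type*} [Field K] [NumberField K] {A β D : ℝ}
    (E : {I : Ideal (𝓞 K) // I ≠ ⊥} × (𝓞 K)ˣ ≃ {p : ℤ × ℤ // p ≠ 0}) (hA : 0 < A) (hD : 0 < D)
    (hE : ∀ q, quadForm A β D (E q).1 = Ideal.absNorm q.1.1) {σ : ℝ} (hσ : 1 < σ) :
    Summable (fun q : {I : Ideal (𝓞 K) // I ≠ ⊥} × (𝓞 K)ˣ =>
      (Ideal.absNorm q.1.1 : ℝ) ^ (-σ)) := by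
  have h := (summable_quadForm_rpow β hA hD hσ).subtype {p | p ≠ 0}
  have h2 := E.summable_iff.2 h
  refine h2.congr (fun q => ?_)
  simp only [Function.comp_apply]
  rw [← hE]

lemma finite_units_of_equiv {K : Type*} [Field K] [NumberField K] {A β D : ℝ}
    (E : {I : Ideal (𝓞 K) // I ≠ ⊥} × (𝓞 K)ˣ ≃ {p : ℤ × ℤ // p ≠ 0}) (hA : 0 < A) (hD : 0 < D)
    (hE : ∀ q, quadForm A β D (E q).1 = Ideal.absNorm q.1.1) : Finite (𝓞 K)ˣ := by
  have h := (summable_absNorm_rpow_prod_units E hA hD hE one_lt_two).prod_factor ⟨⊤, top_ne_bot⟩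
  simp only [Ideal.absNorm_top, Nat.cast_one, Real.one_rpow] at h
  by_contra hinf
  rw [not_finite_iff_infinite] at hinf
  exact one_ne_zero ((summable_const_iff (1 : ℝ)).1 h)

lemma summable_absNorm_rpow {K : Type*} [Field K] [NumberField K] {A β D : ℝ}
    (E : {I : Ideal (𝓞 K) // I ≠ ⊥} × (𝓞 K)ˣ ≃ {p : ℤ × ℤ // p ≠ 0}) (hA : 0 < A) (hD : 0 < D)
    (hE : ∀ q, quadForm A β D (E q).1 = Ideal.absNorm q.1.1) {σ : ℝ} (hσ : 1 < σ) :
    Summable (fun I : {I : Ideal (𝓞 K) // I ≠ ⊥} => (Ideal.absNorm I.1 : ℝ) ^ (-σ)) := by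
  have h := summable_absNorm_rpow_prod_units E hA hD hE hσ
  exact h.comp_injective (i := fun I => (I, 1)) (fun I J h => (Prod.ext_iff.1 h).1)

lemma norm_absNorm_cpow {K : Type*} [Field K] [NumberField K] (I : {I : Ideal (𝓞 K) // I ≠ ⊥})
    (s : ℂ) : ‖(Ideal.absNorm I.1 : ℂ) ^ (-s)‖ = (Ideal.absNorm I.1 : ℝ) ^ (-s.re) := by
  rw [Complex.norm_natCast_cpow_of_pos (Nat.pos_of_ne_zero (by
    rw [Ne, Ideal.absNorm_eq_zero_iff]; exact I.2)), Complex.neg_re]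

lemma hasSum_quadForm_cpow {K : Type*} [Field K] [NumberField K] {A β D : ℝ}
    (E : {I : Ideal (𝓞 K) // I ≠ ⊥} × (𝓞 K)ˣ ≃ {p : ℤ × ℤ // p ≠ 0}) (hA : 0 < A) (hD : 0 < D)
    (hE : ∀ q, quadForm A β D (E q).1 = Ideal.absNorm q.1.1) {s : ℂ} (hs : 1 < s.re) :
    HasSum (fun p : {p : ℤ × ℤ // p ≠ 0} => (quadForm A β D p.1 : ℂ) ^ (-s))
      (Nat.card (𝓞 K)ˣ * dedekindZetaSum K s) := by
  rw [← E.hasSum_iff]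
  have := finite_units_of_equiv E hA hD hE
  have hcongr : (fun p : {p : ℤ × ℤ // p ≠ 0} => (quadForm A β D p.1 : ℂ) ^ (-s)) ∘ E =
      fun q => (Ideal.absNorm q.1.1 : ℂ) ^ (-s) := by
    ext q
    simp [hE]
  rw [hcongr]
  have hsum : Summable (fun q : {I : Ideal (𝓞 K) // I ≠ ⊥} × (𝓞 K)ˣ =>
      (Ideal.absNorm q.1.1 : ℂ) ^ (-s)) := by
    refine Summable.of_norm ((summable_absNorm_rpow_prod_units E hA hD hE hs).congr fun q => ?_)
    rw [norm_absNorm_cpow]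
  convert hsum.hasSum using 1
  rw [hsum.tsum_prod]
  simp only [tsum_const, nsmul_eq_mul]
  rw [tsum_mul_left, dedekindZetaSum]

section EulerProduct

variable {R : Type*} [CommRing R] [IsDedekindDomain R]

open Classical in
lemma tsum_mul_prod_one_sub_eq {𝕜 : Type*} [NormedField 𝕜] [CompleteSpace 𝕜]
    (f : Ideal R → 𝕜) (hmul : ∀ I J, f (I * J) = f I * f J)
    (hsum : Summable fun I : {I : Ideal R // I ≠ ⊥} => ‖f I.1‖)
    (S : Finset (Ideal R)) (hS : ∀ P ∈ S, Prime P) :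
    (∑' I : {I : Ideal R // I ≠ ⊥}, f I.1) * ∏ P ∈ S, (1 - f P) =
      ∑' I : {I : Ideal R // I ≠ ⊥}, if ∃ P ∈ S, P ∣ I.1 then 0 else f I.1 := by
  induction S using Finset.induction_on with
  | empty => simp
  | insert P S hP ih =>
    have hPp : Prime P := hS P (Finset.mem_insert_self P S)
    have hSp : ∀ Q ∈ S, Prime Q := fun Q hQ => hS Q (Finset.mem_insert_of_mem hQ)
    have hsumm : Summable fun I : {I : Ideal R // I ≠ ⊥} =>
        if ∃ P ∈ S, P ∣ I.1 then 0 else f I.1 :=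
      Summable.of_norm_bounded hsum (fun I => by split_ifs <;> simp)
    have hndvd : ∀ (Q : Ideal R) (J : Ideal R), Q ∈ S → (Q ∣ P * J ↔ Q ∣ J) := by
      intro Q J hQ
      refine ⟨fun h => ((hSp Q hQ).dvd_or_dvd h).resolve_left fun hQP => hP ?_,
        fun h => h.mul_left P⟩
      have := (hSp Q hQ).associated_of_dvd hPp hQP
      rw [associated_iff_eq] at this
      exact this ▸ hQ
    rw [Finset.prod_insert hP, mul_left_comm, ih hSp]
    let m : {I : Ideal R // I ≠ ⊥} → {I : Ideal R // I ≠ ⊥} := fun J =>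
      ⟨P * J.1, mul_ne_zero hPp.ne_zero J.2⟩
    have hm : Function.Injective m := fun I J h =>
      Subtype.ext (mul_left_cancel₀ hPp.ne_zero (congrArg Subtype.val h))
    set g : {I : Ideal R // I ≠ ⊥} → 𝕜 := fun I =>
      if P ∣ I.1 then (if ∃ Q ∈ S, Q ∣ I.1 then 0 else f I.1) else 0 with hg
    have hgm : ∑' J, g (m J) = ∑' I, g I := hm.tsum_eq (fun I hI => by
      have hPI : P ∣ I.1 := by
        by_contra h
        exact hI (by simp [hg, h])
      obtain ⟨J, hJ⟩ := hPI
      exact ⟨⟨J, fun h => I.2 (by rw [hJ, h]; exact mul_zero P)⟩, Subtype.ext hJ.symm⟩)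
    have hgm' : ∀ J, g (m J) = f P * (if ∃ Q ∈ S, Q ∣ J.1 then 0 else f J.1) := by
      intro J
      have : (∃ Q ∈ S, Q ∣ P * J.1) ↔ ∃ Q ∈ S, Q ∣ J.1 :=
        exists_congr fun Q => and_congr_right fun hQ => hndvd Q J.1 hQ
      simp only [hg, m, dvd_mul_right, if_true, this, hmul, mul_ite, mul_zero]
    simp only [hgm', tsum_mul_left] at hgm
    have hsg : Summable g := Summable.of_norm_bounded hsum (fun I => by
      simp only [hg]; split_ifs <;> simp)
    rw [sub_mul, one_mul, hgm, ← hsumm.tsum_sub hsg]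
    refine tsum_congr fun I => ?_
    by_cases h1 : P ∣ I.1 <;> by_cases h2 : ∃ Q ∈ S, Q ∣ I.1 <;>
      simp [hg, h1, h2]

open Classical in
lemma exists_norm_tsum_sub_one_lt {𝕜 : Type*} [NormedField 𝕜] [CompleteSpace 𝕜]
    (f : Ideal R → 𝕜) (hone : f ⊤ = 1)
    (hsum : Summable fun I : {I : Ideal R // I ≠ ⊥} => ‖f I.1‖) {ε : ℝ} (hε : 0 < ε) :
    ∃ S : Finset (Ideal R), (∀ P ∈ S, Prime P) ∧
      ‖(∑' I : {I : Ideal R // I ≠ ⊥}, if ∃ P ∈ S, P ∣ I.1 then 0 else f I.1) - 1‖ < ε := by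
  obtain ⟨F, hF⟩ := ((tendsto_order.1 (tendsto_tsum_compl_atTop_zero
    (fun I : {I : Ideal R // I ≠ ⊥} => ‖f I.1‖))).2 ε hε).exists
  have hex : ∀ I : Ideal R, I ≠ ⊤ → ∃ P, Prime P ∧ P ∣ I ∨ I = ⊥ := fun I hI => by
    by_cases h0 : I = ⊥
    · exact ⟨⊤, Or.inr h0⟩
    · obtain ⟨P, hP, hPI⟩ := WfDvdMonoid.exists_irreducible_factor
        (fun h => hI (by rwa [Ideal.isUnit_iff] at h)) h0
      exact ⟨P, Or.inl ⟨hP.prime, hPI⟩⟩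
  choose! π hπ using hex
  have hπ' : ∀ I : {I : Ideal R // I ≠ ⊥}, I.1 ≠ ⊤ → Prime (π I.1) ∧ π I.1 ∣ I.1 :=
    fun I hI => (hπ I.1 hI).resolve_right I.2
  refine ⟨(F.filter fun I => I.1 ≠ ⊤).image fun I => π I.1, fun P hP => ?_, ?_⟩
  · obtain ⟨I, hI, rfl⟩ := Finset.mem_image.1 hP
    exact (hπ' I (Finset.mem_filter.1 hI).2).1
  set S := (F.filter fun I => I.1 ≠ ⊤).image fun I => π I.1 with hSdef
  have hSp : ∀ P ∈ S, Prime P := fun P hP => by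
    obtain ⟨I, hI, rfl⟩ := Finset.mem_image.1 hP
    exact (hπ' I (Finset.mem_filter.1 hI).2).1
  have htop : (if ∃ P ∈ S, P ∣ (⊤ : Ideal R) then 0 else f ⊤) = 1 := by
    rw [if_neg, hone]
    rintro ⟨P, hP, hPt⟩
    exact (hSp P hP).not_isUnit (isUnit_of_dvd_one (by rwa [Ideal.one_eq_top]))
  have hsumm : Summable fun I : {I : Ideal R // I ≠ ⊥} =>
      if ∃ P ∈ S, P ∣ I.1 then 0 else f I.1 :=
    Summable.of_norm_bounded hsum (fun I => by split_ifs <;> simp)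
  rw [hsumm.tsum_eq_add_tsum_ite ⟨⊤, top_ne_bot⟩, htop, add_sub_cancel_left]
  refine lt_of_le_of_lt ?_ hF
  have htail := tsum_subtype {I | I ∉ F} (fun I : {I : Ideal R // I ≠ ⊥} => ‖f I.1‖)
  refine le_of_le_of_eq ?_ htail.symm
  refine tsum_of_norm_bounded ((hsum.indicator _).hasSum) (fun I => ?_)
  by_cases hI : I.1 = ⊤
  · have : I = ⟨⊤, top_ne_bot⟩ := Subtype.ext hI
    rw [if_pos this, norm_zero]
    exact Set.indicator_nonneg (fun _ _ => norm_nonneg _) _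
  · rw [if_neg (fun h => hI (congrArg Subtype.val h))]
    by_cases hIF : I ∈ F
    · rw [if_pos, norm_zero]
      · exact Set.indicator_nonneg (fun _ _ => norm_nonneg _) _
      · exact ⟨π I.1, Finset.mem_image.2 ⟨I, Finset.mem_filter.2 ⟨hIF, hI⟩, rfl⟩, (hπ' I hI).2⟩
    · rw [Set.indicator_of_mem (by exact hIF)]
      split_ifs <;> simp

end EulerProduct

lemma norm_dedekindZetaSum_le {K : Type*} [Field K] [NumberField K] {σ : ℝ}
    (hsum : Summable (fun I : {I : Ideal (𝓞 K) // I ≠ ⊥} => (Ideal.absNorm I.1 : ℝ) ^ (-σ)))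
    {s : ℂ} (hs : σ ≤ s.re) :
    ‖dedekindZetaSum K s‖ ≤ ∑' I : {I : Ideal (𝓞 K) // I ≠ ⊥}, (Ideal.absNorm I.1 : ℝ) ^ (-σ) := by
  refine tsum_of_norm_bounded hsum.hasSum (fun I => ?_)
  rw [norm_absNorm_cpow]
  refine Real.rpow_le_rpow_of_exponent_le ?_ (by linarith)
  exact_mod_cast Nat.one_le_iff_ne_zero.2 (by rw [Ne, Ideal.absNorm_eq_zero_iff]; exact I.2)

lemma one_le_norm_dedekindZetaSum_mul {K : Type*} [Field K] [NumberField K] {σ : ℝ} (hσ : 0 < σ)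
    (hsum : Summable (fun I : {I : Ideal (𝓞 K) // I ≠ ⊥} => (Ideal.absNorm I.1 : ℝ) ^ (-σ)))
    {s : ℂ} (hs : σ ≤ s.re) :
    1 ≤ ‖dedekindZetaSum K s‖ *
      ∑' I : {I : Ideal (𝓞 K) // I ≠ ⊥}, (Ideal.absNorm I.1 : ℝ) ^ (-σ) := by
  classical
  have hle : ∀ I : {I : Ideal (𝓞 K) // I ≠ ⊥},
      ‖(Ideal.absNorm I.1 : ℂ) ^ (-s)‖ ≤ (Ideal.absNorm I.1 : ℝ) ^ (-σ) := fun I => by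
    rw [norm_absNorm_cpow]
    refine Real.rpow_le_rpow_of_exponent_le ?_ (by linarith)
    exact_mod_cast Nat.one_le_iff_ne_zero.2 (by rw [Ne, Ideal.absNorm_eq_zero_iff]; exact I.2)
  have hsum_s : Summable fun I : {I : Ideal (𝓞 K) // I ≠ ⊥} =>
      ‖(Ideal.absNorm I.1 : ℂ) ^ (-s)‖ := Summable.of_nonneg_of_le (fun _ => norm_nonneg _) hle hsum
  have hsum_r : Summable (fun I : {I : Ideal (𝓞 K) // I ≠ ⊥} =>
      ‖(Ideal.absNorm I.1 : ℝ) ^ (-σ)‖) := hsum.norm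
  set Z := ∑' I : {I : Ideal (𝓞 K) // I ≠ ⊥}, (Ideal.absNorm I.1 : ℝ) ^ (-σ) with hZ
  refine le_of_forall_pos_sub_le (fun ε hε => ?_)
  obtain ⟨S, hS, hlt⟩ := exists_norm_tsum_sub_one_lt
    (fun I : Ideal (𝓞 K) => (Ideal.absNorm I : ℂ) ^ (-s)) (by simp) hsum_s hε
  have e1 := tsum_mul_prod_one_sub_eq (fun I : Ideal (𝓞 K) => (Ideal.absNorm I : ℂ) ^ (-s))
    (fun I J => by
      simp only [map_mul, Nat.cast_mul]
      exact Complex.natCast_mul_natCast_cpow _ _ _) hsum_s S hS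
  have e2 := tsum_mul_prod_one_sub_eq (fun I : Ideal (𝓞 K) => (Ideal.absNorm I : ℝ) ^ (-σ))
    (fun I J => by
      simp only [map_mul, Nat.cast_mul]
      exact Real.mul_rpow (by positivity) (by positivity)) hsum_r S hS
  rw [← e1] at hlt
  have hr1 : (1 : ℝ) ≤ ∑' I : {I : Ideal (𝓞 K) // I ≠ ⊥},
      if ∃ P ∈ S, P ∣ I.1 then 0 else (Ideal.absNorm I.1 : ℝ) ^ (-σ) := by
    have hsumm : Summable fun I : {I : Ideal (𝓞 K) // I ≠ ⊥} =>
      if ∃ P ∈ S, P ∣ I.1 then 0 else (Ideal.absNorm I.1 : ℝ) ^ (-σ) :=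
      Summable.of_norm_bounded hsum_r (fun I => by split_ifs <;> simp)
    have := hsumm.le_tsum ⟨⊤, top_ne_bot⟩ (fun I _ => by
      split_ifs
      · exact le_rfl
      · positivity)
    rw [if_neg] at this
    · simpa using this
    · rintro ⟨P, hP, hPt⟩
      exact (hS P hP).not_isUnit (isUnit_of_dvd_one (by rwa [Ideal.one_eq_top]))
  rw [← e2, ← hZ] at hr1
  have hx : ∀ P ∈ S, 0 ≤ (Ideal.absNorm P : ℝ) ^ (-σ) ∧ (Ideal.absNorm P : ℝ) ^ (-σ) ≤ 1 :=
    fun P hP => ⟨by positivity, Real.rpow_le_one_of_one_le_of_nonpos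
      (by exact_mod_cast Nat.one_le_iff_ne_zero.2 (by
        rw [Ne, Ideal.absNorm_eq_zero_iff]; exact (hS P hP).ne_zero)) (by linarith)⟩
  have hprod : (∏ P ∈ S, (1 + (Ideal.absNorm P : ℝ) ^ (-σ))) *
      ∏ P ∈ S, (1 - (Ideal.absNorm P : ℝ) ^ (-σ)) ≤ 1 := by
    rw [← Finset.prod_mul_distrib]
    exact Finset.prod_le_one (fun P hP => mul_nonneg (by linarith [(hx P hP).1])
      (by linarith [(hx P hP).2])) (fun P hP => by nlinarith [(hx P hP).1])
  have hplus : 0 ≤ ∏ P ∈ S, (1 + (Ideal.absNorm P : ℝ) ^ (-σ)) :=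
    Finset.prod_nonneg fun P hP => by linarith [(hx P hP).1]
  have hZ0 : 0 ≤ Z := tsum_nonneg fun _ => by positivity
  have hple : ∏ P ∈ S, (1 + (Ideal.absNorm P : ℝ) ^ (-σ)) ≤ Z := by
    calc _ ≤ (∏ P ∈ S, (1 + (Ideal.absNorm P : ℝ) ^ (-σ))) *
          (Z * ∏ P ∈ S, (1 - (Ideal.absNorm P : ℝ) ^ (-σ))) := le_mul_of_one_le_right hplus hr1
      _ = Z * ((∏ P ∈ S, (1 + (Ideal.absNorm P : ℝ) ^ (-σ))) *
          ∏ P ∈ S, (1 - (Ideal.absNorm P : ℝ) ^ (-σ))) := by ring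
      _ ≤ Z * 1 := mul_le_mul_of_nonneg_left hprod hZ0
      _ = Z := mul_one _
  have hnorm : ‖∏ P ∈ S, (1 - (Ideal.absNorm P : ℂ) ^ (-s))‖ ≤ Z := by
    refine le_trans ?_ hple
    rw [norm_prod]
    refine Finset.prod_le_prod (fun _ _ => norm_nonneg _) (fun P hP => ?_)
    refine (norm_sub_le _ _).trans ?_
    rw [norm_one]
    exact add_le_add_right (hle ⟨P, (hS P hP).ne_zero⟩) 1
  have h1 : 1 - ε ≤ ‖dedekindZetaSum K s * ∏ P ∈ S, (1 - (Ideal.absNorm P : ℂ) ^ (-s))‖ := by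
    have h := norm_sub_norm_le (1 : ℂ) (dedekindZetaSum K s * ∏ P ∈ S,
      (1 - (Ideal.absNorm P : ℂ) ^ (-s)))
    rw [norm_sub_rev, norm_one] at h
    have hlt' : ‖dedekindZetaSum K s * ∏ P ∈ S, (1 - (Ideal.absNorm P : ℂ) ^ (-s)) - 1‖ < ε := hlt
    linarith
  refine h1.trans ?_
  rw [norm_mul]
  exact mul_le_mul_of_nonneg_left hnorm (norm_nonneg _)

open MeasureTheory Set Topology Asymptotics in
lemma exists_norm_mellin_le {h : ℝ → ℂ} (hloc : LocallyIntegrableOn h (Ioi 0))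
    (htop : h =O[atTop] fun t => Real.exp (-1 * t)) (hbot : h =O[𝓝[>] 0] fun t : ℝ => t ^ (-0 : ℝ))
    {a b : ℝ} (ha : 0 < a) :
    ∃ C, ∀ u : ℂ, a ≤ u.re → u.re ≤ b → ‖mellin h u‖ ≤ C := by
  have hconv : ∀ {x : ℝ}, 0 < x → IntegrableOn (fun t : ℝ => t ^ (x - 1) * ‖h t‖) (Ioi 0) :=
    fun {x} hx => by
      have := mellinConvergent_of_isBigO_rpow_exp (s := (x : ℂ)) one_pos hloc htop hbot (by simpa)
      rwa [MellinConvergent, mellin_convergent_iff_norm Subset.rfl measurableSet_Ioi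
        hloc.aestronglyMeasurable, ofReal_re] at this
  refine ⟨∫ t in Ioi (0 : ℝ), (t ^ (a - 1) * ‖h t‖ + t ^ (max a b - 1) * ‖h t‖), fun u h1 h2 => ?_⟩
  refine (norm_integral_le_integral_norm _).trans ?_
  refine integral_mono_of_nonneg (Eventually.of_forall fun t => norm_nonneg _)
    ((hconv ha).add (hconv (ha.trans_le (le_max_left a b)))) ?_
  filter_upwards [ae_restrict_mem measurableSet_Ioi] with t ht
  have ht : 0 < t := ht
  rw [norm_smul, norm_cpow_eq_rpow_re_of_pos ht, ← add_mul]
  refine mul_le_mul_of_nonneg_right ?_ (norm_nonneg _)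
  simp only [sub_re, one_re]
  rcases le_total t 1 with h | h
  · exact (Real.rpow_le_rpow_of_exponent_ge ht h (by linarith)).trans
      (le_add_of_nonneg_right (by positivity))
  · exact (Real.rpow_le_rpow_of_exponent_le h (by linarith [le_max_right a b])).trans
      (le_add_of_nonneg_left (by positivity))

open MeasureTheory Set Topology Asymptotics in
/-- Continuation of the Mellin transform of a function behaving like `c / t - 1` at zero. -/
lemma exists_mellin_continuation {F : ℝ → ℂ} {c : ℂ} (hloc : LocallyIntegrableOn F (Ioi 0))
    (htop : F =O[atTop] fun t => Real.exp (-1 * t))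
    (hbot : (fun t : ℝ => F t - (c * (t : ℂ) ^ (-1 : ℂ) - 1)) =O[𝓝[>] 0] fun _ => (1 : ℝ)) :
    ∃ G : ℂ → ℂ, DifferentiableOn ℂ G {u | 0 < u.re} ∧
      (∀ u, 1 < u.re → mellin F u = G u + (c / (u - 1) - 1 / u)) ∧
      ∀ a b : ℝ, 0 < a → ∃ C, ∀ u : ℂ, a ≤ u.re → u.re ≤ b → ‖G u‖ ≤ C := by
  set m : ℝ → ℂ := fun t => c • indicator (Ioc 0 1) (fun t : ℝ => (t : ℂ) ^ (-1 : ℂ)) t -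
    indicator (Ioc 0 1) (fun _ => (1 : ℂ)) t with hm
  have hmell : ∀ u : ℂ, 1 < u.re → HasMellin m u (c / (u - 1) - 1 / u) := by
    intro u hu
    have h1 := hasMellin_cpow_Ioc (-1) (s := u) (by simp; linarith)
    have h2 := hasMellin_one_Ioc (s := u) (by linarith)
    have h3 := hasMellin_const_smul h1.1 c
    have h4 := hasMellin_sub h3.1 h2.1
    rw [h3.2, h1.2, h2.2, smul_eq_mul, mul_one_div, ← sub_eq_add_neg] at h4
    exact h4
  have hmloc : LocallyIntegrableOn m (Ioi 0) := by
    have h1 : LocallyIntegrableOn (fun t : ℝ => (t : ℂ) ^ (-1 : ℂ)) (Ioi 0) := by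
      refine ContinuousOn.locallyIntegrableOn ?_ measurableSet_Ioi
      exact continuousOn_of_forall_continuousAt fun t ht =>
        continuousAt_ofReal_cpow_const t _ (Or.inr (ne_of_gt ht))
    have h2 : LocallyIntegrableOn (fun t : ℝ => (1 : ℂ)) (Ioi 0) :=
      continuousOn_const.locallyIntegrableOn measurableSet_Ioi
    have hind : ∀ {g : ℝ → ℂ}, LocallyIntegrableOn g (Ioi 0) →
        LocallyIntegrableOn (indicator (Ioc 0 1) g) (Ioi 0) := fun hg x hx => by
      obtain ⟨s, hs, hgs⟩ := hg x hx
      exact ⟨s, hs, hgs.indicator measurableSet_Ioc⟩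
    exact ((hind h1).smul c).sub (hind h2)
  have hhloc : LocallyIntegrableOn (fun t => F t - m t) (Ioi 0) := hloc.sub hmloc
  have hhtop : (fun t => F t - m t) =O[atTop] fun t => Real.exp (-1 * t) := by
    refine htop.congr' ?_ EventuallyEq.rfl
    filter_upwards [eventually_gt_atTop 1] with t ht
    simp [hm, ht]
  have hhbot : (fun t => F t - m t) =O[𝓝[>] 0] fun t : ℝ => t ^ (-0 : ℝ) := by
    simp only [neg_zero, Real.rpow_zero]
    refine hbot.congr' ?_ EventuallyEq.rfl
    filter_upwards [Ioc_mem_nhdsGT (one_pos : (0 : ℝ) < 1)] with t ht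
    simp [hm, indicator_of_mem ht]
  refine ⟨mellin (fun t => F t - m t), fun u hu =>
    (mellin_differentiableAt_of_isBigO_rpow_exp one_pos hhloc hhtop hhbot hu).differentiableWithinAt,
    fun u hu => ?_, fun a b ha => exists_norm_mellin_le hhloc hhtop hhbot ha⟩
  have h1 := mellinConvergent_of_isBigO_rpow_exp one_pos hhloc hhtop hhbot
    (show (0 : ℝ) < u.re by linarith)
  have h2 := hasMellin_add h1 (hmell u hu).1
  rw [(hmell u hu).2] at h2
  simpa using h2.2

open Set Topology in
lemma continuousOn_theta {A D : ℝ} (β : ℝ) (hA : 0 < A) (hD : 0 < D) :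
    ContinuousOn (fun t : ℝ => ∑' p : ℤ × ℤ, Real.exp (-t * quadForm A β D p)) (Ioi 0) := by
  intro x hx
  have hx : 0 < x := hx
  have h : ContinuousOn (fun t : ℝ => ∑' p : ℤ × ℤ, Real.exp (-t * quadForm A β D p))
      (Ioi (x / 2)) := by
    refine continuousOn_tsum (fun p => by fun_prop)
      (summable_exp_neg_quadForm β hA hD (half_pos hx)) fun p t ht => ?_
    rw [Real.norm_eq_abs, Real.abs_exp, Real.exp_le_exp]
    nlinarith [quadForm_nonneg (β := β) hA hD p, mem_Ioi.mp ht]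
  exact (h.continuousAt (Ioi_mem_nhds (half_lt_self hx))).continuousWithinAt

lemma hasSum_theta_sub_one {A D : ℝ} (β : ℝ) (hA : 0 < A) (hD : 0 < D) {t : ℝ} (ht : 0 < t) :
    HasSum (fun p : {p : ℤ × ℤ // p ≠ 0} => Real.exp (-t * quadForm A β D p.1))
      ((∑' p : ℤ × ℤ, Real.exp (-t * quadForm A β D p)) - 1) := by
  classical
  have hs := summable_exp_neg_quadForm β hA hD ht
  have h := hs.hasSum.sub (hasSum_ite_eq (0 : ℤ × ℤ) (1 : ℝ))
  have : Function.support (fun p : ℤ × ℤ => Real.exp (-t * quadForm A β D p) -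
      if p = 0 then 1 else 0) ⊆ Set.range (Subtype.val : {p : ℤ × ℤ // p ≠ 0} → ℤ × ℤ) := by
    intro p hp
    refine ⟨⟨p, ?_⟩, rfl⟩
    rintro rfl
    simp [quadForm] at hp
  rw [← Function.Injective.hasSum_iff Subtype.val_injective
    (fun p hp => Function.notMem_support.mp fun h => hp (this h))] at h
  refine h.congr_fun ?_
  intro p
  simp [p.2]

open Set Topology Asymptotics MeasureTheory in
/-- Continuation of `Γ(u) ζ_K(u)` to the right half-plane, up to the polar terms. -/
lemma exists_Gamma_mul_dedekindZetaSum_continuation {K : Type*} [Field K] [NumberField K]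
    {A β D : ℝ}
    (E : {I : Ideal (𝓞 K) // I ≠ ⊥} × (𝓞 K)ˣ ≃ {p : ℤ × ℤ // p ≠ 0}) (hA : 0 < A) (hD : 0 < D)
    (hE : ∀ q, quadForm A β D (E q).1 = Ideal.absNorm q.1.1) :
    ∃ (c : ℂ) (G : ℂ → ℂ), DifferentiableOn ℂ G {u | 0 < u.re} ∧
      (∀ u, 1 < u.re → Gamma u * (Nat.card (𝓞 K)ˣ * dedekindZetaSum K u) =
        G u + (c / (u - 1) - 1 / u)) ∧
      ∀ a b : ℝ, 0 < a → ∃ C, ∀ u : ℂ, a ≤ u.re → u.re ≤ b → ‖G u‖ ≤ C := by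
  have hQ : ∀ p : {p : ℤ × ℤ // p ≠ 0}, 1 ≤ quadForm A β D p.1 := by
    intro p
    obtain ⟨q, rfl⟩ := E.surjective p
    rw [hE, Nat.one_le_cast, Nat.one_le_iff_ne_zero, Ne, Ideal.absNorm_eq_zero_iff]
    exact q.1.2
  obtain ⟨c, hc⟩ := exists_theta_sub_isBigO β hA hD
  set F : ℝ → ℂ := fun t => (((∑' p : ℤ × ℤ, Real.exp (-t * quadForm A β D p)) - 1 : ℝ) : ℂ) with hF
  have hloc : LocallyIntegrableOn F (Ioi 0) := by
    refine ContinuousOn.locallyIntegrableOn ?_ measurableSet_Ioi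
    exact continuous_ofReal.comp_continuousOn ((continuousOn_theta β hA hD).sub continuousOn_const)
  have htop : F =O[atTop] fun t => Real.exp (-1 * t) := by
    set T := (∑' p : ℤ × ℤ, Real.exp (-1 * quadForm A β D p)) - 1 with hT
    have hT1 := hasSum_theta_sub_one β hA hD one_pos
    refine IsBigO.of_bound (Real.exp 1 * T) ?_
    filter_upwards [eventually_ge_atTop 1] with t ht
    have ht0 : 0 < t := by linarith
    have hs := hasSum_theta_sub_one β hA hD ht0
    have h0 := hs.nonneg fun p => (Real.exp_pos _).le
    rw [hF, norm_real, Real.norm_of_nonneg h0, Real.norm_of_nonneg (Real.exp_pos _).le]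
    have h1 : Real.exp 1 * T * Real.exp (-1 * t) = Real.exp (1 - t) * T := by
      rw [mul_right_comm, ← Real.exp_add]; ring_nf
    rw [h1]
    refine hasSum_le (fun p => ?_) hs (hT1.mul_left _)
    rw [← Real.exp_add, Real.exp_le_exp]
    nlinarith [hQ p]
  have hbot : (fun t : ℝ => F t - ((c : ℂ) * (t : ℂ) ^ (-1 : ℂ) - 1)) =O[𝓝[>] 0]
      fun _ => (1 : ℝ) := by
    refine (isBigO_ofReal_left.mpr hc).congr_left fun t => ?_
    rw [hF, cpow_neg_one]
    push_cast
    ring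
  obtain ⟨G, hG1, hG2, hG3⟩ := exists_mellin_continuation hloc htop hbot
  refine ⟨c, G, hG1, fun u hu => ?_, hG3⟩
  rw [← hG2 u hu]
  have hm := hasSum_mellin (a := fun _ : {p : ℤ × ℤ // p ≠ 0} => (1 : ℂ))
    (p := fun p => quadForm A β D p.1) (F := F) (s := u)
    (fun p => Or.inr (by linarith [hQ p])) (by linarith) (fun t ht => by
      have := Complex.hasSum_ofReal.mpr (hasSum_theta_sub_one β hA hD ht)
      refine this.congr_fun fun p => ?_
      rw [one_mul, neg_mul, neg_mul, mul_comm]) (by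
      refine ((summable_quadForm_rpow β hA hD hu).comp_injective
        (Subtype.val_injective (p := fun p : ℤ × ℤ => p ≠ 0))).congr fun p => ?_
      simp [Real.rpow_neg (quadForm_nonneg hA hD p.1)])
  have h2 := (hasSum_quadForm_cpow E hA hD hE hu).mul_left (Gamma u)
  refine (h2.congr_fun fun p => ?_).unique hm
  rw [cpow_neg, mul_one, div_eq_mul_inv]

lemma dedekindZetaSum_conj (K : Type*) [Field K] [NumberField K] (s : ℂ) :
    dedekindZetaSum K (starRingEnd ℂ s) = starRingEnd ℂ (dedekindZetaSum K s) := by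
  rw [dedekindZetaSum, dedekindZetaSum, conj_tsum]
  refine tsum_congr fun I => ?_
  rw [← map_neg, cpow_conj _ _ (natCast_arg ▸ Real.pi_pos.ne), conj_natCast]

/-- The entire function `s (s - 1) Λ(s)`, with value `r` at the removable singularities. -/
noncomputable def xiOf (Λ : ℂ → ℂ) (r s : ℂ) : ℂ :=
  open Classical in if s = 0 ∨ s = 1 then r else s * (s - 1) * Λ s

section Xi

variable {K : Type*} [Field K] [NumberField K] {Λ : ℂ → ℂ} {r : ℂ}

lemma xiOf_of_ne {s : ℂ} (h0 : s ≠ 0) (h1 : s ≠ 1) : xiOf Λ r s = s * (s - 1) * Λ s := by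
  simp [xiOf, h0, h1]

lemma xiOf_zero : xiOf Λ r 0 = r := by simp [xiOf]

lemma xiOf_one : xiOf Λ r 1 = r := by simp [xiOf]

lemma xiOf_one_sub (hΛ : IsCompletedDedekindZeta K Λ) (s : ℂ) :
    xiOf Λ r (1 - s) = xiOf Λ r s := by
  by_cases h0 : s = 0
  · rw [h0, sub_zero, xiOf_one, xiOf_zero]
  by_cases h1 : s = 1
  · rw [h1, sub_self, xiOf_one, xiOf_zero]
  rw [xiOf_of_ne h0 h1, xiOf_of_ne (sub_ne_zero.mpr (Ne.symm h1)) (by simpa using h0),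
    ← hΛ.functional_equation]
  ring

open Topology in
lemma differentiable_xiOf (hΛ : IsCompletedDedekindZeta K Λ)
    (hr : Tendsto (fun s : ℂ => (s - 1) * Λ s) (𝓝[≠] 1) (𝓝 r)) :
    Differentiable ℂ (xiOf Λ r) := by
  have hopen : IsOpen ({(0 : ℂ), 1}ᶜ : Set ℂ) := (Set.toFinite _).isClosed.isOpen_compl
  have hgen : ∀ s : ℂ, s ≠ 0 → s ≠ 1 → DifferentiableAt ℂ (xiOf Λ r) s := by
    intro s h0 h1
    have hmem : ({(0 : ℂ), 1}ᶜ : Set ℂ) ∈ 𝓝 s := hopen.mem_nhds (by simp [h0, h1])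
    have h : DifferentiableAt ℂ (fun s => s * (s - 1) * Λ s) s := by
      have := hΛ.differentiableOn.differentiableAt hmem
      fun_prop
    refine h.congr_of_eventuallyEq ?_
    filter_upwards [hmem] with z hz
    simp only [Set.mem_compl_iff, Set.mem_insert_iff, Set.mem_singleton_iff, not_or] at hz
    exact xiOf_of_ne hz.1 hz.2
  have hne : ∀ᶠ z in 𝓝[≠] (1 : ℂ), z ≠ 0 ∧ z ≠ 1 := by
    filter_upwards [self_mem_nhdsWithin,
      nhdsWithin_le_nhds (isOpen_ne.mem_nhds (one_ne_zero : (1 : ℂ) ≠ 0))] with z h1 h0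
    exact ⟨h0, h1⟩
  have hone : DifferentiableAt ℂ (xiOf Λ r) 1 := by
    refine (analyticAt_of_differentiable_on_punctured_nhds_of_continuousAt
      (hne.mono fun z hz => hgen z hz.1 hz.2) ?_).differentiableAt
    rw [continuousAt_iff_punctured_nhds, xiOf_one]
    have hid : Tendsto (fun s : ℂ => s) (𝓝[≠] 1) (𝓝 1) := nhdsWithin_le_nhds
    have := hid.mul hr
    rw [one_mul] at this
    refine this.congr' (hne.mono fun z hz => ?_)
    rw [xiOf_of_ne hz.1 hz.2, mul_assoc]
  intro s
  by_cases h1 : s = 1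
  · exact h1 ▸ hone
  by_cases h0 : s = 0
  · have h : xiOf Λ r = fun z => xiOf Λ r (1 - z) := funext fun z => (xiOf_one_sub hΛ z).symm
    rw [h, h0]
    refine DifferentiableAt.comp (0 : ℂ) (g := xiOf Λ r) (f := fun z => 1 - z) ?_ (by fun_prop)
    simpa using hone
  exact hgen s h0 h1

lemma xiOf_eq_of_one_lt (hΛ : IsCompletedDedekindZeta K Λ) {s : ℂ} (hs : 1 < s.re) :
    xiOf Λ r s = s * (s - 1) *
      (((Real.sqrt |(NumberField.discr K : ℝ)| / (2 * Real.pi) : ℝ) : ℂ) ^ s *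
        Complex.Gamma s * dedekindZetaSum K s) := by
  rw [xiOf_of_ne, hΛ.eq_on_gt_one s hs]
  · rintro rfl; norm_num at hs
  · rintro rfl; norm_num at hs

lemma completedFactor_pos (K : Type*) [Field K] [NumberField K] :
    0 < Real.sqrt |(NumberField.discr K : ℝ)| / (2 * Real.pi) := by
  have : (NumberField.discr K : ℝ) ≠ 0 := Int.cast_ne_zero.mpr (NumberField.discr_ne_zero K)
  positivity

open Topology in
lemma xiOf_conj (hΛ : IsCompletedDedekindZeta K Λ)
    (hr : Tendsto (fun s : ℂ => (s - 1) * Λ s) (𝓝[≠] 1) (𝓝 r)) (s : ℂ) :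
    xiOf Λ r (starRingEnd ℂ s) = starRingEnd ℂ (xiOf Λ r s) := by
  have hd := differentiable_xiOf hΛ hr
  have hd2 : Differentiable ℂ (starRingEnd ℂ ∘ xiOf Λ r ∘ starRingEnd ℂ) := fun z => by
    simpa using (hd (starRingEnd ℂ z)).conj_conj
  have h : xiOf Λ r = starRingEnd ℂ ∘ xiOf Λ r ∘ starRingEnd ℂ := by
    refine AnalyticOnNhd.eq_of_eventuallyEq (z₀ := 2) (fun z _ => hd.analyticAt z)
      (fun z _ => hd2.analyticAt z) ?_
    have hmem : {z : ℂ | 1 < z.re} ∈ 𝓝 (2 : ℂ) :=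
      (isOpen_lt continuous_const continuous_re).mem_nhds (by norm_num)
    filter_upwards [hmem] with z hz
    have hz : 1 < z.re := hz
    have hz' : 1 < (starRingEnd ℂ z).re := by rwa [conj_re]
    rw [Function.comp_apply, Function.comp_apply, xiOf_eq_of_one_lt hΛ hz,
      xiOf_eq_of_one_lt hΛ hz', Gamma_conj, dedekindZetaSum_conj, cpow_conj, conj_ofReal]
    · simp
    · rw [arg_ofReal_of_nonneg (completedFactor_pos K).le]
      exact Real.pi_pos.ne
  have := congrFun h (starRingEnd ℂ s)
  simpa using this

end Xi

open Topology Set in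
lemma exists_norm_xiOf_le_of_half_le {K : Type*} [Field K] [NumberField K] {Λ : ℂ → ℂ} {r : ℂ}
    (hΛ : IsCompletedDedekindZeta K Λ)
    (hr : Tendsto (fun s : ℂ => (s - 1) * Λ s) (𝓝[≠] 1) (𝓝 r)) {A β D : ℝ}
    (E : {I : Ideal (𝓞 K) // I ≠ ⊥} × (𝓞 K)ˣ ≃ {p : ℤ × ℤ // p ≠ 0}) (hA : 0 < A) (hD : 0 < D)
    (hE : ∀ q, quadForm A β D (E q).1 = Ideal.absNorm q.1.1) (b : ℝ) :
    ∃ C, 0 ≤ C ∧ ∀ u : ℂ, 1 / 2 ≤ u.re → u.re ≤ b → ‖xiOf Λ r u‖ ≤ C * (1 + ‖u‖) ^ 2 := by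
  obtain ⟨c, G, hG1, hG2, hG3⟩ := exists_Gamma_mul_dedekindZetaSum_continuation E hA hD hE
  set q : ℝ := Real.sqrt |(NumberField.discr K : ℝ)| / (2 * Real.pi) with hq
  have hq0 : 0 < q := completedFactor_pos K
  have := finite_units_of_equiv E hA hD hE
  set w : ℂ := (Nat.card (𝓞 K)ˣ : ℂ) with hw
  have hw0 : 1 ≤ ‖w‖ := by
    rw [hw, norm_natCast, Nat.one_le_cast]
    exact Nat.card_pos
  have hd := differentiable_xiOf hΛ hr
  have hopen : IsOpen {u : ℂ | 0 < u.re} := isOpen_lt continuous_const continuous_re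
  have heq : EqOn (fun u => w * xiOf Λ r u)
      (fun u => (q : ℂ) ^ u * (u * (u - 1) * G u + (c * u - (u - 1)))) {u | 0 < u.re} := by
    have hqd : Differentiable ℂ fun u : ℂ => (q : ℂ) ^ u := fun u =>
      differentiableAt_id.const_cpow (Or.inl (ofReal_ne_zero.mpr hq0.ne'))
    refine AnalyticOnNhd.eqOn_of_preconnected_of_eventuallyEq (z₀ := 2)
      ((hd.const_mul w).differentiableOn.analyticOnNhd hopen)
      (DifferentiableOn.analyticOnNhd ?_ hopen) ?_ (by norm_num) ?_
    · exact hqd.differentiableOn.mul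
        (((by fun_prop : DifferentiableOn ℂ (fun u : ℂ => u * (u - 1)) {u | 0 < u.re}).mul hG1).add
          (by fun_prop))
    · exact (convex_halfSpace_re_gt 0).isPreconnected
    · have hmem : {z : ℂ | 1 < z.re} ∈ 𝓝 (2 : ℂ) :=
        (isOpen_lt continuous_const continuous_re).mem_nhds (by norm_num)
      filter_upwards [hmem] with u hu
      have hu : 1 < u.re := hu
      have h0 : u ≠ 0 := by rintro rfl; norm_num at hu
      have h1 : u - 1 ≠ 0 := by
        rw [sub_ne_zero]; rintro rfl; norm_num at hu
      have h2 := hG2 u hu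
      rw [xiOf_eq_of_one_lt hΛ hu]
      calc _ = (q : ℂ) ^ u * (u * (u - 1) * (Gamma u * (w * dedekindZetaSum K u))) := by ring
        _ = _ := by rw [h2]; field_simp
  obtain ⟨C, hC⟩ := hG3 (1 / 2) b (by norm_num)
  have hC' : ∀ u : ℂ, 1 / 2 ≤ u.re → u.re ≤ b → ‖G u‖ ≤ max C 0 := fun u h1 h2 =>
    (hC u h1 h2).trans (le_max_left _ _)
  refine ⟨(q ^ (1 / 2 : ℝ) + q ^ b) * (max C 0 + ‖c‖ + 1), by positivity, fun u h1 h2 => ?_⟩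
  have hu : 0 < u.re := by linarith
  have hle : ‖xiOf Λ r u‖ ≤ ‖w * xiOf Λ r u‖ := by
    rw [norm_mul]
    exact le_mul_of_one_le_left (norm_nonneg _) hw0
  refine hle.trans ?_
  have := heq hu
  simp only at this
  rw [this, norm_mul, norm_cpow_eq_rpow_re_of_pos hq0, mul_assoc (q ^ (1 / 2 : ℝ) + q ^ b)]
  have hqb : q ^ u.re ≤ q ^ (1 / 2 : ℝ) + q ^ b := by
    rcases le_total q 1 with h | h
    · exact (Real.rpow_le_rpow_of_exponent_ge hq0 h h1).trans
        (le_add_of_nonneg_right (by positivity))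
    · exact (Real.rpow_le_rpow_of_exponent_le h h2).trans
        (le_add_of_nonneg_left (by positivity))
  refine mul_le_mul hqb ?_ (norm_nonneg _) (by positivity)
  have hu1 : ‖u - 1‖ ≤ 1 + ‖u‖ := by
    refine (norm_sub_le _ _).trans ?_
    simp [add_comm]
  have hN := norm_nonneg u
  have hone : 1 + ‖u‖ ≤ (1 + ‖u‖) ^ 2 := by nlinarith
  calc ‖u * (u - 1) * G u + (c * u - (u - 1))‖
      ≤ ‖u‖ * ‖u - 1‖ * ‖G u‖ + (‖c‖ * ‖u‖ + ‖u - 1‖) := by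
        refine (norm_add_le _ _).trans (add_le_add (by rw [norm_mul, norm_mul]) ?_)
        exact (norm_sub_le _ _).trans (by rw [norm_mul])
    _ ≤ (1 + ‖u‖) * (1 + ‖u‖) * max C 0 + (‖c‖ * (1 + ‖u‖) ^ 2 + (1 + ‖u‖) ^ 2) := by
        gcongr
        · linarith
        · exact hC' u h1 h2
        · linarith
        · linarith
    _ = _ := by ring

open Topology Set in
/-- Polynomial growth of `s (s - 1) Λ(s)` in vertical strips. -/
lemma exists_norm_xiOf_le {K : Type*} [Field K] [NumberField K] {Λ : ℂ → ℂ} {r : ℂ}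
    (hΛ : IsCompletedDedekindZeta K Λ)
    (hr : Tendsto (fun s : ℂ => (s - 1) * Λ s) (𝓝[≠] 1) (𝓝 r)) {A β D : ℝ}
    (E : {I : Ideal (𝓞 K) // I ≠ ⊥} × (𝓞 K)ˣ ≃ {p : ℤ × ℤ // p ≠ 0}) (hA : 0 < A) (hD : 0 < D)
    (hE : ∀ q, quadForm A β D (E q).1 = Ideal.absNorm q.1.1) (b : ℝ) :
    ∃ C, 0 ≤ C ∧ ∀ u : ℂ, 1 - b ≤ u.re → u.re ≤ b → ‖xiOf Λ r u‖ ≤ C * (2 + ‖u‖) ^ 2 := by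
  obtain ⟨C, hC0, hC⟩ := exists_norm_xiOf_le_of_half_le hΛ hr E hA hD hE b
  refine ⟨C, hC0, fun u h1 h2 => ?_⟩
  rcases le_total (1 / 2) u.re with h | h
  · refine (hC u h h2).trans ?_
    gcongr
    norm_num
  · rw [← xiOf_one_sub hΛ]
    refine (hC (1 - u) (by simp; linarith) (by simp; linarith)).trans ?_
    have : ‖1 - u‖ ≤ 1 + ‖u‖ := (norm_sub_le _ _).trans (by simp)
    have : 1 + ‖1 - u‖ ≤ 2 + ‖u‖ := by linarith
    gcongr

open MeasureTheory Set in
lemma norm_Gamma_le_Gamma_re {s : ℂ} (hs : 0 < s.re) : ‖Complex.Gamma s‖ ≤ Real.Gamma s.re := by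
  rw [Complex.Gamma_eq_integral hs, Real.Gamma_eq_integral hs, Complex.GammaIntegral]
  refine (norm_integral_le_integral_norm _).trans (le_of_eq ?_)
  refine setIntegral_congr_fun measurableSet_Ioi fun x hx => ?_
  have hx : 0 < x := hx
  simp only [norm_mul]
  rw [norm_cpow_eq_rpow_re_of_pos hx, norm_real, Real.norm_of_nonneg (Real.exp_pos _).le]
  simp

lemma norm_betaIntegral_le_one {u v : ℂ} (hu : 1 ≤ u.re) (hv : 1 ≤ v.re) :
    ‖betaIntegral u v‖ ≤ 1 := by
  rw [betaIntegral]
  refine (intervalIntegral.norm_integral_le_of_norm_le_const (C := 1) fun x hx => ?_).trans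
    (by norm_num)
  rw [Set.uIoc_of_le zero_le_one] at hx
  obtain ⟨h0, h1⟩ := hx
  rw [norm_mul]
  refine mul_le_one₀ ?_ (norm_nonneg _) ?_
  · rw [norm_cpow_eq_rpow_re_of_pos h0]
    exact Real.rpow_le_one h0.le h1 (by simp; linarith)
  · rcases h1.eq_or_lt with rfl | h1
    · rw [ofReal_one, sub_self]
      rcases eq_or_ne (v - 1) 0 with h | h
      · rw [h, cpow_zero, norm_one]
      · rw [zero_cpow h, norm_zero]
        exact zero_le_one
    · rw [← ofReal_one, ← ofReal_sub, norm_cpow_eq_rpow_re_of_pos (by linarith)]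
      exact Real.rpow_le_one (by linarith) (by linarith) (by simp; linarith)

lemma norm_Gamma_mul_le {u : ℂ} {h : ℝ} (hu : 1 ≤ u.re) (hh : 1 ≤ h) :
    ‖Complex.Gamma u‖ * Real.Gamma h ≤ ‖Complex.Gamma (u + h)‖ := by
  have h1 := Gamma_mul_Gamma_eq_betaIntegral (s := u) (t := (h : ℂ)) (by linarith)
    (by rw [ofReal_re]; linarith)
  have h2 := congrArg norm h1
  rw [norm_mul, norm_mul, Complex.Gamma_ofReal, norm_real,
    Real.norm_of_nonneg (Real.Gamma_pos_of_pos (by linarith)).le] at h2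
  rw [h2]
  exact mul_le_of_le_one_right (norm_nonneg _) (norm_betaIntegral_le_one hu (by simpa))

lemma norm_sin_le_exp_norm (z : ℂ) : ‖Complex.sin z‖ ≤ Real.exp ‖z‖ := by
  rw [Complex.sin, norm_div, norm_mul, norm_I, mul_one, norm_ofNat, div_le_iff₀ two_pos]
  have h : ∀ w : ℂ, ‖w‖ = ‖z‖ → ‖Complex.exp w‖ ≤ Real.exp ‖z‖ := fun w hw => by
    rw [norm_exp, Real.exp_le_exp, ← hw]
    exact re_le_norm w
  refine (norm_sub_le _ _).trans ?_
  linarith [h (-z * I) (by simp), h (z * I) (by simp)]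

/-- An exponential lower bound for the Gamma function in a vertical strip. -/
lemma exists_one_le_exp_mul_norm_Gamma :
    ∃ C, 0 ≤ C ∧ ∀ v : ℂ, 1 ≤ v.re → v.re ≤ 9 / 2 → 1 ≤ |v.im| →
      1 ≤ C * Real.exp (Real.pi * ‖v‖) * ‖Complex.Gamma v‖ := by
  refine ⟨max (Real.Gamma (1 / 2)) (Real.Gamma 4), ?_, fun v h1 h2 him => ?_⟩
  · exact le_max_of_le_left (Real.Gamma_pos_of_pos (by norm_num)).le
  set M := max (Real.Gamma (1 / 2)) (Real.Gamma 4)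
  have hne : ∀ k : ℂ, k.im = 0 → 1 ≤ ‖k - v‖ := fun k hk => by
    refine him.trans ?_
    have := abs_im_le_norm (k - v)
    rwa [sub_im, hk, zero_sub, abs_neg] at this
  have hne0 : ∀ k : ℂ, k.im = 0 → k - v ≠ 0 := fun k hk h => by
    have := hne k hk
    rw [h, norm_zero] at this
    norm_num at this
  have hG : ‖Complex.Gamma (1 - v)‖ ≤ M := by
    have h5 : ‖Complex.Gamma (5 - v)‖ ≤ M := by
      refine (norm_Gamma_le_Gamma_re (by simp; linarith)).trans ?_
      refine Real.convexOn_Gamma.le_max_of_mem_Icc (by norm_num) (by norm_num) ⟨?_, ?_⟩ <;>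
        simp <;> linarith
    have hstep : ∀ k : ℂ, k.im = 0 → ‖Complex.Gamma (k - v)‖ ≤ ‖Complex.Gamma (k + 1 - v)‖ := by
      intro k hk
      rw [add_sub_right_comm, Complex.Gamma_add_one _ (hne0 k hk), norm_mul]
      exact le_mul_of_one_le_left (norm_nonneg _) (hne k hk)
    refine le_trans ?_ h5
    have e1 := hstep 1 (by simp)
    have e2 := hstep 2 (by simp)
    have e3 := hstep 3 (by simp)
    have e4 := hstep 4 (by simp)
    norm_num at e1 e2 e3 e4
    exact ((e1.trans e2).trans e3).trans e4
  have hrefl := Complex.Gamma_mul_Gamma_one_sub v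
  have hsin : Complex.sin (Real.pi * v) ≠ 0 := by
    rw [Complex.sin_ne_zero_iff]
    intro k hk
    rw [mul_comm] at hk
    have := mul_right_cancel₀ (ofReal_ne_zero.mpr Real.pi_pos.ne') hk
    rw [this] at him
    norm_num at him
  have hn := congrArg norm hrefl
  rw [norm_mul, norm_div, norm_real, Real.norm_of_nonneg Real.pi_pos.le,
    eq_div_iff (norm_ne_zero_iff.mpr hsin)] at hn
  have hs : ‖Complex.sin (Real.pi * v)‖ ≤ Real.exp (Real.pi * ‖v‖) := by
    refine (norm_sin_le_exp_norm _).trans_eq ?_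
    rw [norm_mul, norm_real, Real.norm_of_nonneg Real.pi_pos.le]
  calc (1 : ℝ) ≤ Real.pi := by linarith [Real.pi_gt_three]
    _ = ‖Complex.Gamma v‖ * ‖Complex.Gamma (1 - v)‖ * ‖Complex.sin (Real.pi * v)‖ := hn.symm
    _ ≤ ‖Complex.Gamma v‖ * M * Real.exp (Real.pi * ‖v‖) := by gcongr
    _ = _ := by ring

section Ratio

variable {K : Type*} [Field K] [NumberField K] {Λ : ℂ → ℂ} {r : ℂ}

lemma norm_xiOf_eq (hΛ : IsCompletedDedekindZeta K Λ) {s : ℂ} (hs : 1 < s.re) :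
    ‖xiOf Λ r s‖ = ‖s‖ * ‖s - 1‖ *
      ((Real.sqrt |(NumberField.discr K : ℝ)| / (2 * Real.pi)) ^ s.re *
        ‖Complex.Gamma s‖ * ‖dedekindZetaSum K s‖) := by
  rw [xiOf_eq_of_one_lt hΛ hs, norm_mul, norm_mul, norm_mul, norm_mul,
    norm_cpow_eq_rpow_re_of_pos (completedFactor_pos K)]

lemma xiOf_ne_zero (hΛ : IsCompletedDedekindZeta K Λ)
    (hZ : ∀ σ : ℝ, 1 < σ → Summable (fun I : {I : Ideal (𝓞 K) // I ≠ ⊥} =>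
      (Ideal.absNorm I.1 : ℝ) ^ (-σ))) {s : ℂ} (hs : 1 < s.re) : xiOf Λ r s ≠ 0 := by
  have h0 : s ≠ 0 := by rintro rfl; norm_num at hs
  have h1 : s - 1 ≠ 0 := by rw [sub_ne_zero]; rintro rfl; norm_num at hs
  have hz : dedekindZetaSum K s ≠ 0 := by
    intro h
    have := one_le_norm_dedekindZetaSum_mul (by linarith) (hZ s.re hs) le_rfl
    rw [h, norm_zero, zero_mul] at this
    norm_num at this
  have hG := Complex.Gamma_ne_zero_of_re_pos (show 0 < s.re by linarith)
  have hq : ((Real.sqrt |(NumberField.discr K : ℝ)| / (2 * Real.pi) : ℝ) : ℂ) ^ s ≠ 0 := by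
    rw [Ne, cpow_eq_zero_iff, not_and_or]
    exact Or.inl (ofReal_ne_zero.mpr (completedFactor_pos K).ne')
  rw [xiOf_eq_of_one_lt hΛ hs]
  exact mul_ne_zero (mul_ne_zero h0 h1) (mul_ne_zero (mul_ne_zero hq hG) hz)

lemma exists_norm_xiOf_le_mul_norm_xiOf_add (hΛ : IsCompletedDedekindZeta K Λ)
    (hZ : ∀ σ : ℝ, 1 < σ → Summable (fun I : {I : Ideal (𝓞 K) // I ≠ ⊥} =>
      (Ideal.absNorm I.1 : ℝ) ^ (-σ))) {h : ℝ} (hh : 1 ≤ h) :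
    ∃ C, 0 ≤ C ∧ ∀ u : ℂ, 2 ≤ u.re → ‖xiOf Λ r u‖ ≤ C * ‖xiOf Λ r (u + h)‖ := by
  set q : ℝ := Real.sqrt |(NumberField.discr K : ℝ)| / (2 * Real.pi) with hq
  have hq0 : 0 < q := completedFactor_pos K
  have hZ2 := hZ 2 one_lt_two
  set Z := ∑' I : {I : Ideal (𝓞 K) // I ≠ ⊥}, (Ideal.absNorm I.1 : ℝ) ^ (-(2 : ℝ)) with hZdef
  have hZ0 : 0 ≤ Z := tsum_nonneg fun I => by positivity
  have hΓ := Real.Gamma_pos_of_pos (show 0 < h by linarith)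
  refine ⟨q ^ (-h) * (Real.Gamma h)⁻¹ * Z ^ 2, by positivity, fun u hu => ?_⟩
  have hv : 2 ≤ (u + h).re := by simp; linarith
  have hnorm : ‖u‖ ≤ ‖u + h‖ := by
    rw [Complex.norm_def, Complex.norm_def, normSq_apply, normSq_apply]
    refine Real.sqrt_le_sqrt ?_
    simp
    nlinarith
  have hnorm1 : ‖u - 1‖ ≤ ‖u + h - 1‖ := by
    rw [Complex.norm_def, Complex.norm_def, normSq_apply, normSq_apply]
    refine Real.sqrt_le_sqrt ?_
    simp
    nlinarith
  have hGam : ‖Complex.Gamma u‖ ≤ (Real.Gamma h)⁻¹ * ‖Complex.Gamma (u + h)‖ := by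
    rw [← div_eq_inv_mul, le_div_iff₀ hΓ]
    exact norm_Gamma_mul_le (by linarith) hh
  have hzu : ‖dedekindZetaSum K u‖ ≤ Z ^ 2 * ‖dedekindZetaSum K (u + h)‖ := by
    have h1 := norm_dedekindZetaSum_le hZ2 hu
    have h2 := one_le_norm_dedekindZetaSum_mul two_pos hZ2 hv
    rw [← hZdef] at h1 h2
    nlinarith
  have hqu : q ^ u.re = q ^ (-h) * q ^ (u + h).re := by
    rw [← Real.rpow_add hq0]
    simp
  rw [norm_xiOf_eq hΛ (by linarith), norm_xiOf_eq hΛ (by linarith), ← hq, hqu]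
  calc ‖u‖ * ‖u - 1‖ * (q ^ (-h) * q ^ (u + h).re * ‖Complex.Gamma u‖ * ‖dedekindZetaSum K u‖)
      ≤ ‖u + h‖ * ‖u + h - 1‖ * (q ^ (-h) * q ^ (u + h).re *
        ((Real.Gamma h)⁻¹ * ‖Complex.Gamma (u + h)‖) *
          (Z ^ 2 * ‖dedekindZetaSum K (u + h)‖)) := by gcongr
    _ = _ := by ring

lemma exists_one_le_exp_mul_norm_xiOf (hΛ : IsCompletedDedekindZeta K Λ)
    (hZ : ∀ σ : ℝ, 1 < σ → Summable (fun I : {I : Ideal (𝓞 K) // I ≠ ⊥} =>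
      (Ideal.absNorm I.1 : ℝ) ^ (-σ))) {σ : ℝ} (hσ : 1 < σ) :
    ∃ C, 0 ≤ C ∧ ∀ v : ℂ, σ ≤ v.re → v.re ≤ 9 / 2 → 1 ≤ |v.im| →
      1 ≤ C * Real.exp (Real.pi * ‖v‖) * ‖xiOf Λ r v‖ := by
  set q : ℝ := Real.sqrt |(NumberField.discr K : ℝ)| / (2 * Real.pi) with hq
  have hq0 : 0 < q := completedFactor_pos K
  have hZs := hZ σ hσ
  set Z := ∑' I : {I : Ideal (𝓞 K) // I ≠ ⊥}, (Ideal.absNorm I.1 : ℝ) ^ (-σ) with hZdef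
  have hZ0 : 0 ≤ Z := tsum_nonneg fun I => by positivity
  obtain ⟨C, hC0, hC⟩ := exists_one_le_exp_mul_norm_Gamma
  refine ⟨C * Z * (q ^ (-σ) + q ^ (-(9 / 2 : ℝ))), by positivity, fun v h1 h2 h3 => ?_⟩
  have hz := one_le_norm_dedekindZetaSum_mul (by linarith) hZs h1
  rw [← hZdef] at hz
  have hG := hC v (by linarith) h2 h3
  have hqv : 1 ≤ (q ^ (-σ) + q ^ (-(9 / 2 : ℝ))) * q ^ v.re := by
    rw [add_mul, ← Real.rpow_add hq0, ← Real.rpow_add hq0]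
    rcases le_total q 1 with h | h
    · exact (Real.one_le_rpow_of_pos_of_le_one_of_nonpos hq0 h (by linarith)).trans
        (le_add_of_nonneg_left (by positivity))
    · exact (Real.one_le_rpow h (by linarith)).trans
        (le_add_of_nonneg_right (by positivity))
  have hv : 1 ≤ ‖v‖ := h3.trans (abs_im_le_norm v)
  have hv1 : 1 ≤ ‖v - 1‖ := by
    refine h3.trans ?_
    simpa using abs_im_le_norm (v - 1)
  rw [norm_xiOf_eq hΛ (by linarith), ← hq]
  calc (1 : ℝ) = 1 * 1 * (1 * 1 * 1) := by norm_num
    _ ≤ ‖v‖ * ‖v - 1‖ * (((q ^ (-σ) + q ^ (-(9 / 2 : ℝ))) * q ^ v.re) *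
        (C * Real.exp (Real.pi * ‖v‖) * ‖Complex.Gamma v‖) * (‖dedekindZetaSum K v‖ * Z)) := by
          gcongr
    _ = _ := by ring

end Ratio

open Topology Set Asymptotics Bornology in
lemma norm_xiOf_sub_le_norm_xiOf_add {K : Type*} [Field K] [NumberField K] {Λ : ℂ → ℂ} {r : ℂ}
    (hΛ : IsCompletedDedekindZeta K Λ)
    (hr : Tendsto (fun s : ℂ => (s - 1) * Λ s) (𝓝[≠] 1) (𝓝 r))
    (hZ : ∀ σ : ℝ, 1 < σ → Summable (fun I : {I : Ideal (𝓞 K) // I ≠ ⊥} =>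
      (Ideal.absNorm I.1 : ℝ) ^ (-σ)))
    (hgrow : ∀ b : ℝ, ∃ C, 0 ≤ C ∧ ∀ u : ℂ, 1 - b ≤ u.re → u.re ≤ b →
      ‖xiOf Λ r u‖ ≤ C * (2 + ‖u‖) ^ 2)
    {δ : ℝ} (hδ : 0 < δ) (hδ' : δ < 1 / 2) {z : ℂ} (hz : 0 ≤ z.re) :
    ‖xiOf Λ r (z - δ)‖ ≤ ‖xiOf Λ r (z + (1 + δ : ℝ))‖ := by
  have hd := differentiable_xiOf hΛ hr
  have hne : ∀ z : ℂ, 0 ≤ z.re → xiOf Λ r (z + (1 + δ : ℝ)) ≠ 0 := fun z hz =>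
    xiOf_ne_zero hΛ hZ (by rw [add_re, ofReal_re]; linarith)
  set f : ℂ → ℂ := fun z => xiOf Λ r (z - δ) / xiOf Λ r (z + (1 + δ : ℝ)) with hf
  obtain ⟨C₁, hC₁0, hC₁⟩ := exists_norm_xiOf_le_mul_norm_xiOf_add (r := r) hΛ hZ
    (show (1 : ℝ) ≤ 1 + 2 * δ by linarith)
  obtain ⟨C₂, hC₂0, hC₂⟩ := exists_one_le_exp_mul_norm_xiOf (r := r) hΛ hZ
    (show (1 : ℝ) < 1 + δ by linarith)
  obtain ⟨C₃, hC₃0, hC₃⟩ := hgrow 3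
  have hright : ∀ z : ℂ, 3 ≤ z.re → ‖f z‖ ≤ C₁ := fun z hz => by
    rw [hf, norm_div, div_le_iff₀ (norm_pos_iff.mpr (hne z (by linarith)))]
    refine (hC₁ (z - δ) (by rw [sub_re, ofReal_re]; linarith)).trans_eq ?_
    congr 3
    push_cast
    ring
  have hstrip : ∀ z : ℂ, 0 ≤ z.re → z.re ≤ 3 → 1 ≤ |z.im| →
      ‖f z‖ ≤ C₃ * C₂ * Real.exp (2 * Real.pi) * 9 * Real.exp ((Real.pi + 2) * ‖z‖) := by
    intro z h1 h2 h3
    rw [hf, norm_div, div_le_iff₀ (norm_pos_iff.mpr (hne z h1))]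
    have hnum := hC₃ (z - δ) (by rw [sub_re, ofReal_re]; linarith)
      (by rw [sub_re, ofReal_re]; linarith)
    have hden := hC₂ (z + (1 + δ : ℝ)) (by rw [add_re, ofReal_re]; linarith)
      (by rw [add_re, ofReal_re]; linarith) (by rwa [add_im, ofReal_im, add_zero])
    have hn1 : ‖z - δ‖ ≤ ‖z‖ + 1 := by
      refine (norm_sub_le _ _).trans ?_
      rw [norm_real, Real.norm_of_nonneg hδ.le]
      linarith
    have hn2 : ‖z + (1 + δ : ℝ)‖ ≤ ‖z‖ + 2 := by
      refine (norm_add_le _ _).trans ?_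
      rw [norm_real, Real.norm_of_nonneg (by linarith)]
      linarith
    have hpoly : (2 + ‖z - δ‖) ^ 2 ≤ 9 * Real.exp (2 * ‖z‖) := by
      have h : 2 + ‖z - δ‖ ≤ 3 * Real.exp ‖z‖ := by
        have := Real.add_one_le_exp ‖z‖
        linarith [norm_nonneg z]
      calc (2 + ‖z - δ‖) ^ 2 ≤ (3 * Real.exp ‖z‖) ^ 2 := by gcongr
        _ = _ := by rw [mul_pow, ← Real.exp_nat_mul]; norm_num
    have hexp : Real.exp (Real.pi * ‖z + (1 + δ : ℝ)‖) ≤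
        Real.exp (2 * Real.pi) * Real.exp (Real.pi * ‖z‖) := by
      rw [← Real.exp_add, Real.exp_le_exp]
      nlinarith [Real.pi_pos]
    calc ‖xiOf Λ r (z - δ)‖ ≤ C₃ * (9 * Real.exp (2 * ‖z‖)) * 1 := by
          rw [mul_one]
          exact hnum.trans (by gcongr)
      _ ≤ C₃ * (9 * Real.exp (2 * ‖z‖)) * (C₂ * (Real.exp (2 * Real.pi) *
          Real.exp (Real.pi * ‖z‖)) * ‖xiOf Λ r (z + (1 + δ : ℝ))‖) := by
          gcongr
          refine hden.trans ?_
          gcongr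
      _ = _ := by rw [add_mul, Real.exp_add]; ring
  have key : ‖f z‖ ≤ 1 := by
    refine PhragmenLindelof.right_half_plane_of_bounded_on_real (f := f) ?_ ?_ ?_ ?_ hz
    · refine DifferentiableOn.diffContOnCl fun z hz => ?_
      have hz : 0 ≤ z.re := by
        have := closure_lt_subset_le continuous_const continuous_re hz
        exact this
      refine DifferentiableAt.differentiableWithinAt ?_
      exact ((hd _).comp z (by fun_prop)).div ((hd _).comp z (by fun_prop)) (hne z hz)
    · refine ⟨1, one_lt_two, Real.pi + 2, IsBigO.of_bound
        (max C₁ (C₃ * C₂ * Real.exp (2 * Real.pi) * 9)) ?_⟩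
      rw [eventually_inf_principal]
      filter_upwards [eventually_cobounded_le_norm (E := ℂ) 4] with z hz4 hz0
      have hz0 : 0 < z.re := hz0
      rw [Real.rpow_one, Real.norm_of_nonneg (Real.exp_pos _).le]
      rcases le_total 3 z.re with h | h
      · refine (hright z h).trans ((le_max_left C₁
          (C₃ * C₂ * Real.exp (2 * Real.pi) * 9)).trans ?_)
        refine le_mul_of_one_le_right (le_max_of_le_left hC₁0) (Real.one_le_exp ?_)
        positivity
      · have him : 1 ≤ |z.im| := by
          have := Complex.norm_le_abs_re_add_abs_im z
          rw [abs_of_pos hz0] at this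
          linarith
        refine (hstrip z hz0.le h him).trans ?_
        gcongr
        exact le_max_right _ _
    · refine isBoundedUnder_of_eventually_le (a := C₁) ?_
      filter_upwards [eventually_ge_atTop 3] with x hx
      exact hright x (by simpa)
    · intro x
      rw [hf, norm_div, ← xiOf_one_sub hΛ]
      have : 1 - ((x : ℂ) * I - δ) = starRingEnd ℂ (x * I + (1 + δ : ℝ)) := by
        rw [map_add, map_mul, conj_ofReal, conj_ofReal, conj_I]
        push_cast
        ring
      rw [this, xiOf_conj hΛ hr, norm_conj]
      exact div_self_le_one _
  rwa [hf, norm_div, div_le_one (norm_pos_iff.mpr (hne z hz))] at key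

open Topology Set in
lemma norm_xiOf_two_sub_le {K : Type*} [Field K] [NumberField K] {Λ : ℂ → ℂ} {r : ℂ}
    (hΛ : IsCompletedDedekindZeta K Λ)
    (hr : Tendsto (fun s : ℂ => (s - 1) * Λ s) (𝓝[≠] 1) (𝓝 r))
    (hZ : ∀ σ : ℝ, 1 < σ → Summable (fun I : {I : Ideal (𝓞 K) // I ≠ ⊥} =>
      (Ideal.absNorm I.1 : ℝ) ^ (-σ)))
    (hgrow : ∀ b : ℝ, ∃ C, 0 ≤ C ∧ ∀ u : ℂ, 1 - b ≤ u.re → u.re ≤ b →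
      ‖xiOf Λ r u‖ ≤ C * (2 + ‖u‖) ^ 2) {s : ℂ} (hs : 1 ≤ s.re) :
    ‖xiOf Λ r (2 - s)‖ ≤ ‖xiOf Λ r s‖ := by
  have hc := (differentiable_xiOf hΛ hr).continuous
  have hev : ∀ᶠ δ : ℝ in 𝓝[>] 0,
      ‖xiOf Λ r (s - 1 - δ)‖ ≤ ‖xiOf Λ r (s - 1 + (1 + δ : ℝ))‖ := by
    filter_upwards [Ioo_mem_nhdsGT (show (0 : ℝ) < 1 / 2 by norm_num)] with δ hδ
    exact norm_xiOf_sub_le_norm_xiOf_add hΛ hr hZ hgrow hδ.1 hδ.2 (by simpa)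
  have h1 : Tendsto (fun δ : ℝ => ‖xiOf Λ r (s - 1 - δ)‖) (𝓝[>] 0) (𝓝 ‖xiOf Λ r (s - 1)‖) := by
    have : Continuous fun δ : ℝ => ‖xiOf Λ r (s - 1 - δ)‖ := by fun_prop
    refine (this.tendsto' 0 _ ?_).mono_left nhdsWithin_le_nhds
    simp
  have h2 : Tendsto (fun δ : ℝ => ‖xiOf Λ r (s - 1 + (1 + δ : ℝ))‖) (𝓝[>] 0)
      (𝓝 ‖xiOf Λ r s‖) := by
    have : Continuous fun δ : ℝ => ‖xiOf Λ r (s - 1 + (1 + δ : ℝ))‖ := by fun_prop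
    refine (this.tendsto' 0 _ ?_).mono_left nhdsWithin_le_nhds
    simp
  have := le_of_tendsto_of_tendsto h1 h2 hev
  rwa [← xiOf_one_sub hΛ, show 1 - (s - 1) = 2 - s by ring] at this

/-- The automorphism `z ↦ (z + a) / (1 + conj a * z)` of the unit disc. -/
noncomputable def discShift (a z : ℂ) : ℂ := (z + a) / (1 + starRingEnd ℂ a * z)

lemma one_add_conj_mul_ne_zero {a z : ℂ} (ha : ‖a‖ < 1) (hz : ‖z‖ ≤ 1) :
    1 + starRingEnd ℂ a * z ≠ 0 := by
  intro h
  have h1 : starRingEnd ℂ a * z = -1 := by linear_combination h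
  have h2 := congrArg norm h1
  rw [norm_mul, norm_conj, norm_neg, norm_one] at h2
  nlinarith [norm_nonneg a, norm_nonneg z]

lemma norm_one_add_conj_mul_sq_sub (a z : ℂ) :
    ‖1 + starRingEnd ℂ a * z‖ ^ 2 - ‖z + a‖ ^ 2 = (1 - ‖z‖ ^ 2) * (1 - ‖a‖ ^ 2) := by
  simp only [← normSq_eq_norm_sq, normSq_apply, add_re, add_im, mul_re, mul_im, conj_re, conj_im,
    one_re, one_im]
  ring

lemma norm_discShift_le_one {a z : ℂ} (ha : ‖a‖ < 1) (hz : ‖z‖ ≤ 1) : ‖discShift a z‖ ≤ 1 := by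
  rw [discShift, norm_div, div_le_one (norm_pos_iff.mpr (one_add_conj_mul_ne_zero ha hz))]
  refine le_of_sq_le_sq ?_ (norm_nonneg _)
  have h := norm_one_add_conj_mul_sq_sub a z
  have : 0 ≤ (1 - ‖z‖ ^ 2) * (1 - ‖a‖ ^ 2) :=
    mul_nonneg (by nlinarith [norm_nonneg z]) (by nlinarith [norm_nonneg a])
  linarith

lemma norm_discShift_lt_one {a z : ℂ} (ha : ‖a‖ < 1) (hz : ‖z‖ < 1) : ‖discShift a z‖ < 1 := by
  rw [discShift, norm_div, div_lt_one (norm_pos_iff.mpr (one_add_conj_mul_ne_zero ha hz.le))]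
  refine lt_of_pow_lt_pow_left₀ 2 (norm_nonneg _) ?_
  have h := norm_one_add_conj_mul_sq_sub a z
  have : 0 < (1 - ‖z‖ ^ 2) * (1 - ‖a‖ ^ 2) :=
    mul_pos (by nlinarith [norm_nonneg z]) (by nlinarith [norm_nonneg a])
  linarith

lemma discShift_neg_discShift {a z : ℂ} (ha : ‖a‖ < 1) (hz : ‖z‖ < 1) :
    discShift (-a) (discShift a z) = z := by
  have h1 := one_add_conj_mul_ne_zero ha hz.le
  have h2 := one_add_conj_mul_ne_zero (a := -a) (by rwa [norm_neg]) (norm_discShift_lt_one ha hz).le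
  rw [discShift, div_eq_iff h2, map_neg]
  have ht : discShift a z * (1 + starRingEnd ℂ a * z) = z + a := div_mul_cancel₀ _ h1
  linear_combination ht

lemma differentiableAt_discShift {a z : ℂ} (ha : ‖a‖ < 1) (hz : ‖z‖ ≤ 1) :
    DifferentiableAt ℂ (discShift a) z := by
  unfold discShift
  exact DifferentiableAt.div (by fun_prop) (by fun_prop) (one_add_conj_mul_ne_zero ha hz)

open Set Metric in
/-- A holomorphic self-map of the unit disc with two distinct fixed points is the identity. -/
lemma eqOn_id_of_two_fixed_points {g : ℂ → ℂ} (hd : DifferentiableOn ℂ g (ball 0 1))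
    (hm : MapsTo g (ball 0 1) (closedBall 0 1)) {a b : ℂ} (ha : ‖a‖ < 1) (hb : ‖b‖ < 1)
    (hab : a ≠ b) (hga : g a = a) (hgb : g b = b) : EqOn g id (ball 0 1) := by
  have hna : ‖-a‖ < 1 := by rwa [norm_neg]
  have hm' : ∀ z, ‖z‖ < 1 → ‖g z‖ ≤ 1 := fun z hz => by
    simpa using hm (show z ∈ ball (0 : ℂ) 1 by simpa)
  set h : ℂ → ℂ := fun z => discShift (-a) (g (discShift a z)) with hh
  have h0 : h 0 = 0 := by simp [hh, discShift, hga]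
  have hdh : DifferentiableOn ℂ h (ball 0 1) := by
    intro z hz
    have hz : ‖z‖ < 1 := by simpa using hz
    have h1 := norm_discShift_lt_one ha hz
    have hg : DifferentiableAt ℂ g (discShift a z) :=
      hd.differentiableAt (isOpen_ball.mem_nhds (by simpa using h1))
    have h2 := differentiableAt_discShift hna (hm' _ h1)
    exact (h2.comp z (hg.comp z (differentiableAt_discShift ha hz.le))).differentiableWithinAt
  have hmh : MapsTo h (ball 0 1) (closedBall (h 0) 1) := by
    intro z hz
    have hz : ‖z‖ < 1 := by simpa using hz
    rw [h0, mem_closedBall_zero_iff]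
    exact norm_discShift_le_one hna (hm' _ (norm_discShift_lt_one ha hz))
  set ζ := discShift (-a) b with hζ
  have hζ1 : ‖ζ‖ < 1 := norm_discShift_lt_one hna hb
  have hψζ : discShift a ζ = b := by
    have := discShift_neg_discShift hna hb
    rwa [neg_neg] at this
  have hfix : h ζ = ζ := by rw [hh]; simp only [hψζ, hgb]; rfl
  have hζ0 : ζ ≠ 0 := by
    intro h
    rw [h] at hψζ
    simp [discShift] at hψζ
    exact hab hψζ
  have hslope : dslope h 0 ζ = 1 := by
    rw [dslope_of_ne _ hζ0, slope_def_field, hfix, h0, sub_zero, div_self hζ0]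
  have haff := affine_of_mapsTo_ball_of_norm_dslope_eq_div hdh hmh
    (show ζ ∈ ball (0 : ℂ) 1 by simpa using hζ1) (by rw [hslope]; simp)
  intro w hw
  have hw : ‖w‖ < 1 := by simpa using hw
  have hz1 := norm_discShift_lt_one hna hw
  have hback : discShift a (discShift (-a) w) = w := by
    have := discShift_neg_discShift hna hw
    rwa [neg_neg] at this
  have h3 := haff (show discShift (-a) w ∈ ball (0 : ℂ) 1 by simpa using hz1)
  simp only [hslope, h0, smul_eq_mul, mul_one, zero_add, sub_zero] at h3
  have h4 : discShift (-a) (g w) = discShift (-a) w := by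
    simpa only [hh, hback] using h3
  have hinj : ∀ x, ‖x‖ ≤ 1 → discShift (-a) x = discShift (-a) w → x = w := by
    intro x hx he
    have e1 := one_add_conj_mul_ne_zero hna hx
    have e2 := one_add_conj_mul_ne_zero hna hw.le
    rw [discShift, discShift, div_eq_div_iff e1 e2, map_neg] at he
    have hne : (1 : ℂ) - starRingEnd ℂ a * a ≠ 0 := by
      have := one_add_conj_mul_ne_zero hna ha.le
      rw [map_neg] at this
      intro h
      exact this (by linear_combination h)
    refine sub_eq_zero.mp ((mul_eq_zero.mp (?_ : (1 - starRingEnd ℂ a * a) * (x - w) = 0)).resolve_left hne)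
    linear_combination he
  exact hinj _ (hm' w hw) h4

lemma phiK_two_sub {K : Type*} [Field K] [NumberField K] {Λ : ℂ → ℂ}
    (hΛ : IsCompletedDedekindZeta K Λ) (a : ℝ) (s : ℂ) : phiK Λ a (2 - s) = phiK Λ a s := by
  rw [phiK, phiK, hΛ.functional_equation (2 - s), hΛ.functional_equation s, sub_sub_cancel,
    show 1 - (2 - s) = s - 1 by ring, show 2 - s - 1 = 1 - s by ring]
  ring

lemma one_lt_re_two_div_one_add {w : ℂ} (hw : ‖w‖ < 1) : 1 < (2 / (1 + w)).re := by
  have hne : 1 + w ≠ 0 := fun h => by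
    have : w = -1 := by linear_combination h
    rw [this, norm_neg, norm_one] at hw
    exact hw.false
  have h1 : normSq w < 1 := by
    rw [normSq_eq_norm_sq]
    nlinarith [norm_nonneg w]
  rw [div_re, ← add_div, lt_div_iff₀ (normSq_pos.mpr hne)]
  simp only [normSq_apply, add_re, add_im, one_re, one_im, re_ofNat, im_ofNat] at h1 ⊢
  nlinarith

open Topology Set Metric in
lemma phiK_ne_zero_of_one_lt_re {K : Type*} [Field K] [NumberField K] {Λ : ℂ → ℂ} {r : ℂ}
    (hΛ : IsCompletedDedekindZeta K Λ) (hr0 : r ≠ 0)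
    (hr : Tendsto (fun s : ℂ => (s - 1) * Λ s) (𝓝[≠] 1) (𝓝 r))
    (hne : ∀ s : ℂ, 1 < s.re → xiOf Λ r s ≠ 0)
    (hle : ∀ s : ℂ, 1 ≤ s.re → ‖xiOf Λ r (2 - s)‖ ≤ ‖xiOf Λ r s‖)
    {a : ℝ} (ha : 1 ≤ a) {s : ℂ} (hs : 1 < s.re) (him : s.im ≠ 0) : phiK Λ a s ≠ 0 := by
  intro hzero
  have ha0 : 0 < a := by linarith
  have haC : (a : ℂ) ≠ 0 := ofReal_ne_zero.mpr ha0.ne'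
  have hd := differentiable_xiOf hΛ hr
  set M : ℂ → ℂ := fun s => (a : ℂ) ^ (2 - 2 * s) * xiOf Λ r (2 - s) / xiOf Λ r s with hM
  have hMle : ∀ s : ℂ, 1 < s.re → ‖M s‖ ≤ 1 := fun s hs => by
    rw [hM, norm_div, norm_mul, div_le_one (norm_pos_iff.mpr (hne s hs)),
      norm_cpow_eq_rpow_re_of_pos ha0]
    refine (mul_le_of_le_one_left (norm_nonneg _) ?_).trans (hle s hs.le)
    exact Real.rpow_le_one_of_one_le_of_nonpos ha (by simp; linarith)
  have hMd : ∀ s : ℂ, 1 < s.re → DifferentiableAt ℂ M s := fun s hs => by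
    refine DifferentiableAt.div (DifferentiableAt.mul ?_ ?_) (hd s) (hne s hs)
    · exact DifferentiableAt.const_cpow (by fun_prop) (Or.inl haC)
    · exact (hd _).comp s (by fun_prop)
  have hc2 : starRingEnd ℂ 2 = 2 := map_ofNat _ 2
  have hMconj : ∀ s : ℂ, M (starRingEnd ℂ s) = starRingEnd ℂ (M s) := fun s => by
    have h1 : 2 - starRingEnd ℂ s = starRingEnd ℂ (2 - s) := by simp [hc2]
    have h2 : 2 - 2 * starRingEnd ℂ s = starRingEnd ℂ (2 - 2 * s) := by simp [hc2]
    simp only [hM]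
    rw [h1, h2, xiOf_conj hΛ hr, xiOf_conj hΛ hr, cpow_conj, conj_ofReal, ← map_mul, ← map_div₀]
    rw [arg_ofReal_of_nonneg ha0.le]
    exact Real.pi_pos.ne
  have hs0 : s ≠ 0 := by rintro rfl; simp at him
  have hs1 : s ≠ 1 := by rintro rfl; simp at him
  have hs2 : 2 - s ≠ 0 := by intro h; rw [sub_eq_zero] at h; rw [← h] at him; simp at him
  have hs21 : 2 - s ≠ 1 := by
    intro h; exact hs1 (by linear_combination -h)
  have hMs : M s = (2 - s) / s := by
    have hξ := hne s hs
    simp only [hM]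
    rw [div_eq_div_iff hξ hs0, xiOf_of_ne hs2 hs21, xiOf_of_ne hs0 hs1]
    rw [phiK, hΛ.functional_equation (s - 1), show 1 - (s - 1) = 2 - s by ring,
      show 2 - s = s + (2 - 2 * s) by ring, cpow_add _ _ haC, mul_assoc, ← mul_add,
      show s + (2 - 2 * s) = 2 - s by ring] at hzero
    have h0 := (mul_eq_zero.mp hzero).resolve_left (by
      rw [cpow_eq_zero_iff, not_and_or]
      exact Or.inl haC)
    linear_combination (2 - s) * (1 - s) * s * h0
  set w := (2 - s) / s with hw
  have hw1 : 1 + w = 2 / s := by rw [hw]; field_simp; ring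
  have hsw : 2 / (1 + w) = s := by rw [hw1, div_div_cancel₀ two_ne_zero]
  have hwlt : ‖w‖ < 1 := by
    rw [hw, norm_div, div_lt_one (norm_pos_iff.mpr hs0), Complex.norm_def, Complex.norm_def]
    refine Real.sqrt_lt_sqrt (normSq_nonneg _) ?_
    rw [normSq_apply, normSq_apply]
    simp
    nlinarith
  have hwc : w ≠ starRingEnd ℂ w := by
    intro h
    have h2 : starRingEnd ℂ s = s := by
      conv_rhs => rw [← hsw, h]
      conv_lhs => rw [← hsw]
      simp [hc2]
    exact him (conj_eq_iff_im.mp h2)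
  set g : ℂ → ℂ := fun w => M (2 / (1 + w)) with hg
  have hgd : DifferentiableOn ℂ g (ball 0 1) := fun z hz => by
    have hz : ‖z‖ < 1 := by simpa using hz
    have hre := one_lt_re_two_div_one_add hz
    have h1 : 1 + z ≠ 0 := by
      intro h
      rw [h] at hre
      norm_num at hre
    have h2 : DifferentiableAt ℂ (fun w : ℂ => 2 / (1 + w)) z :=
      DifferentiableAt.div (by fun_prop) (by fun_prop) h1
    exact ((hMd _ hre).comp z h2).differentiableWithinAt
  have hgm : MapsTo g (ball 0 1) (closedBall 0 1) := fun z hz => by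
    have hz : ‖z‖ < 1 := by simpa using hz
    rw [mem_closedBall_zero_iff]
    exact hMle _ (one_lt_re_two_div_one_add hz)
  have hgw : g w = w := by simp only [hg]; rw [hsw, hMs]
  have hgwc : g (starRingEnd ℂ w) = starRingEnd ℂ w := by
    have : 2 / (1 + starRingEnd ℂ w) = starRingEnd ℂ (2 / (1 + w)) := by simp [hc2]
    simp only [hg]
    rw [this, hMconj, hsw, hMs]
  have hid := eqOn_id_of_two_fixed_points hgd hgm hwlt (by rwa [norm_conj]) hwc hgw hgwc
    (show (0 : ℂ) ∈ ball (0 : ℂ) 1 by simp)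
  simp only [hg, hM, id, add_zero, div_one, sub_self, xiOf_zero] at hid
  rw [div_eq_zero_iff, mul_eq_zero, cpow_eq_zero_iff] at hid
  rcases hid with (h | h) | h
  · exact haC h.1
  · exact hr0 h
  · exact hne 2 (by norm_num) h

/-- For `K` imaginary quadratic of class number one and every `a ≥ 1`, every non-real
zero of `φ_K(a,·)` lies on the line `Re(s) = 1`. -/
theorem phiK_nonreal_zeros_on_line (K : Type*) [Field K] [NumberField K]
    (hdeg : Module.finrank ℚ K = 2)
    (himag : ∀ v : NumberField.InfinitePlace K, v.IsComplex)
    (hclass : NumberField.classNumber K = 1)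
    (ΛK : ℂ → ℂ) (hΛ : IsCompletedDedekindZeta K ΛK)
    (a : ℝ) (ha : 1 ≤ a) (s : ℂ) (hs : s.im ≠ 0) (hzero : phiK ΛK a s = 0) :
    s.re = 1 := by
  obtain ⟨A, β, D, E, hA, hD, hE⟩ := exists_ideal_unit_equiv K hdeg himag hclass
  obtain ⟨r, hr0, hr⟩ := hΛ.simple_pole_at_one
  have hZ : ∀ σ : ℝ, 1 < σ → Summable (fun I : {I : Ideal (𝓞 K) // I ≠ ⊥} =>
      (Ideal.absNorm I.1 : ℝ) ^ (-σ)) := fun σ hσ => summable_absNorm_rpow E hA hD hE hσ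
  have key : ∀ z : ℂ, 1 < z.re → z.im ≠ 0 → phiK ΛK a z ≠ 0 := fun z hz him =>
    phiK_ne_zero_of_one_lt_re hΛ hr0 hr (fun s hs => xiOf_ne_zero hΛ hZ hs)
      (fun s hs => norm_xiOf_two_sub_le hΛ hr hZ (exists_norm_xiOf_le hΛ hr E hA hD hE) hs) ha hz him
  rcases lt_trichotomy s.re 1 with h | h | h
  · refine absurd ((phiK_two_sub hΛ a s).trans hzero) (key _ ?_ ?_)
    · simp
      linarith
    · simpa using hs
  · exact h
  · exact absurd hzero (key s h hs)
end
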